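/- Under the assumptions of the main mask-to-image theorem (L > 0; R₀, h̃, a₁, m₁, δ depending on L only; R ≥ 10R₀; p > 4; δ̃ ≤ min{h̃, a₁/2}; G̃ = G + ψ with ψ ∈ W^{2,1}(ℝ²) and ‖ψ‖_{W^{1,1}} ≤ δ̃; h ∈ [1/3, 2/3]; 0 < s' ≤ 1 (s' playing the role of ss₀); J ∈ C⁰(ℝ²) with ‖J − 1‖_{L^∞(B_{2R})} ≤ ε(σ̃₀) and γ ≤ γ₀ chosen so small, depending on L, R, ‖D²ψ‖_{L¹}, p and s' only, that 2(C₇/s')(ε+γ^{1/p}) ≤ 1/6 and (C₈/s')(ε+γ^{1/p}) ≤ a₁/24): define for u ∈ 𝒜_γ the intensity I(u)(x) = ∬ u(ξ) G̃_{s'}(x−ξ) J(ξ−η) G̃_{s'}(x−η) u(η) dξ dη and the exposed set Ω(u) = {x ∈ ℝ² : I(u)(x) > h}. Then there exists a continuous increasing function g: [0,+∞) → [0,+∞) with g(0) = 0, independent of u, such that for every u ∈ 𝒜_γ, every ε' > 0 and every x ∈ ℝ²: if dist(x, ∂Ω(u)) ≥ ε' then |I(u)(x) − h| > g(ε'). 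-/

import Mathlib

open MeasureTheory Metric Set

noncomputable section

abbrev E2 : Type := EuclideanSpace ℝ (Fin 2)

/-- A bounded open set `Ω ⊆ ℝ²` is Lipschitz with constants `r` and `L`. -/
def IsLipDomain (r L : ℝ) (Ω : Set E2) : Prop :=
  ∀ x ∈ frontier Ω, ∃ (A : E2 ≃ᵢ E2) (φ : ℝ → ℝ),
    A x = 0 ∧ LipschitzWith (Real.toNNReal L) φ ∧ φ 0 = 0 ∧
    ∀ y ∈ ball x r, (y ∈ Ω ↔ (A y) 1 < φ ((A y) 0))

/-- The standard Gaussian on the plane, `G x = (2π)⁻¹ exp (-|x|²/2)`. -/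
def Gauss : E2 → ℝ := fun x => (2 * Real.pi)⁻¹ * Real.exp (-‖x‖ ^ 2 / 2)

/-- Convolution `χ_D ∗ K` of the characteristic function of `D` with a kernel `K`. -/
def convK (D : Set E2) (K : E2 → ℝ) (x : E2) : ℝ :=
  ∫ y, D.indicator (fun _ => (1 : ℝ)) y * K (x - y)

/-- `g` is the weak partial derivative of `f` in the direction of the `i`-th coordinate. -/
def IsWeakPartialDeriv (i : Fin 2) (f g : E2 → ℝ) : Prop :=
  ∀ φ : E2 → ℝ, ContDiff ℝ (⊤ : ℕ∞) φ → HasCompactSupport φ →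
    ∫ x, f x * fderiv ℝ φ x (EuclideanSpace.single i 1) = -∫ x, g x * φ x

/-- Rescaling `f_s (x) = s⁻² f (x / s)`. -/
def resc (s : ℝ) (f : E2 → ℝ) : E2 → ℝ := fun x => (s⁻¹) ^ 2 * f (s⁻¹ • x)

/-- The Hopkins areal image intensity
`I(u)(x) = ∬ u ξ G̃ₛ (x-ξ) J (ξ-η) G̃ₛ (x-η) u η dξ dη`. -/
def intensity (Gt : E2 → ℝ) (s : ℝ) (J u : E2 → ℝ) (x : E2) : ℝ :=
  ∫ ξ, ∫ η, u ξ * resc s Gt (x - ξ) * J (ξ - η) * resc s Gt (x - η) * u η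

/-- The exposed region `Ω(u) = {x : I(u)(x) > h}`. -/
def exposed (Gt : E2 → ℝ) (s : ℝ) (J u : E2 → ℝ) (h : ℝ) : Set E2 :=
  {x | h < intensity Gt s J u x}

/-- Membership in the class `𝒜_γ`: a measurable `u : ℝ² → [0,1]` vanishing outside `B_R`,
within `L¹`-distance `γ` of the characteristic function of some open `D ⊆ B_R` which is
Lipschitz with constants `r` and `L`. -/
def MemAgamma (R r L γ : ℝ) (u : E2 → ℝ) : Prop :=
  Measurable u ∧ (∀ x, u x ∈ Icc (0 : ℝ) 1) ∧ (∀ x, x ∉ ball (0 : E2) R → u x = 0) ∧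
  ∃ D : Set E2, IsOpen D ∧ D ⊆ ball (0 : E2) R ∧ IsLipDomain r L D ∧
    (∫ x, |u x - D.indicator (fun _ => (1 : ℝ)) x|) ≤ γ

open Filter Topology Convolution ContinuousLinearMap in
lemma approx_exists (w : E2 → ℝ) (hw : Measurable w) (M : ℝ) (hb : ∀ x, |w x| ≤ M) :
    ∃ W : ℕ → E2 → ℝ, (∀ n, ContDiff ℝ (⊤ : ℕ∞) (W n)) ∧ (∀ n, HasCompactSupport (W n)) ∧
      (∀ n x, |W n x| ≤ M) ∧ ∀ᵐ x, Tendsto (fun n => W n x) atTop (𝓝 (w x)) := by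
  have hM : 0 ≤ M := (abs_nonneg _).trans (hb 0)
  have hli : LocallyIntegrable w volume := by
    rw [locallyIntegrable_iff]
    intro k hk
    refine Measure.integrableOn_of_bounded (M := M) hk.measure_lt_top.ne hw.aestronglyMeasurable ?_
    exact Eventually.of_forall hb
  let φ : ℕ → ContDiffBump (0 : E2) := fun n =>
    ⟨1 / (n + 1 : ℝ), 2 / (n + 1 : ℝ), by positivity, by
      gcongr; norm_num⟩
  let θ : ℕ → ContDiffBump (0 : E2) := fun n =>
    ⟨(n + 1 : ℝ), (n + 2 : ℝ), by positivity, by linarith⟩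
  have hconv := ContDiffBump.ae_convolution_tendsto_right_of_locallyIntegrable (μ := (volume : Measure E2))
    (φ := φ) (l := atTop) (K := 2) (g := w) ?_ ?_ hli
  rotate_left
  · have : Tendsto (fun n : ℕ => 2 * (1 / ((n : ℝ) + 1))) atTop (𝓝 (2 * 0)) :=
      tendsto_one_div_add_atTop_nhds_zero_nat.const_mul 2
    simp only [mul_zero] at this
    refine this.congr fun n => ?_
    simp only [φ]; ring
  · refine Eventually.of_forall fun n => ?_
    simp only [φ]; apply le_of_eq; ring
  refine ⟨fun n x => θ n x * (((φ n).normed volume) ⋆[lsmul ℝ ℝ, volume] w) x, ?_, ?_, ?_, ?_⟩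
  · intro n
    refine (θ n).contDiff.mul ?_
    exact (φ n).hasCompactSupport_normed.contDiff_convolution_left _ (φ n).contDiff_normed hli
  · intro n
    exact (θ n).hasCompactSupport.mul_right
  · intro n x
    rw [abs_mul]
    have h1 : |θ n x| ≤ 1 := by
      rw [abs_of_nonneg (θ n).nonneg]; exact (θ n).le_one
    have h2 : |(((φ n).normed volume) ⋆[lsmul ℝ ℝ, volume] w) x| ≤ M := by
      rw [convolution_def, ← Real.norm_eq_abs]
      calc _ ≤ ∫ t, (φ n).normed volume t * M := by
            refine norm_integral_le_of_norm_le ((φ n).integrable_normed.mul_const M) ?_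
            refine Eventually.of_forall fun t => ?_
            simp only [lsmul_apply, smul_eq_mul, norm_mul, Real.norm_eq_abs,
              abs_of_nonneg ((φ n).nonneg_normed t)]
            exact mul_le_mul_of_nonneg_left (hb _) ((φ n).nonneg_normed t)
        _ = M := by rw [integral_mul_const, (φ n).integral_normed, one_mul]
    calc _ ≤ 1 * M := mul_le_mul h1 h2 (abs_nonneg _) zero_le_one
      _ = M := one_mul M
  · filter_upwards [hconv] with x hx
    have : Tendsto (fun n => θ n x) atTop (𝓝 1) := by
      refine tendsto_const_nhds.congr' ?_
      obtain ⟨N, hN⟩ := exists_nat_ge ‖x‖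
      filter_upwards [eventually_ge_atTop N] with n hn
      symm
      apply (θ n).one_of_mem_closedBall
      simp only [θ, mem_closedBall, dist_zero_right]
      have : (N : ℝ) ≤ n := by exact_mod_cast hn
      linarith
    simpa using this.mul hx

lemma sub_integrable {f : E2 → ℝ} (hf : Integrable f) (z : E2) : Integrable (fun y => f (z - y)) :=
  hf.comp_sub_left z

lemma mul_sub_integrable {f w : E2 → ℝ} (hf : Integrable f) (hw : AEStronglyMeasurable w volume) {M : ℝ}
    (hb : ∀ x, |w x| ≤ M) (z : E2) : Integrable (fun y => w y * f (z - y)) :=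
  (sub_integrable hf z).bdd_mul (c := M) hw (Filter.Eventually.of_forall hb)

lemma abs_conv_le {f w : E2 → ℝ} (hf : Integrable f) {M : ℝ}
    (hb : ∀ x, |w x| ≤ M) (z : E2) : |∫ y, w y * f (z - y)| ≤ M * ∫ y, |f y| := by
  rw [← Real.norm_eq_abs]
  calc _ ≤ ∫ y, M * |f (z - y)| := by
        refine norm_integral_le_of_norm_le ((sub_integrable hf z).abs.const_mul M) ?_
        refine Filter.Eventually.of_forall fun t => ?_
        simp only [norm_mul, Real.norm_eq_abs]
        exact mul_le_mul_of_nonneg_right (hb _) (abs_nonneg _)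
    _ = _ := by rw [integral_const_mul, integral_sub_left_eq_self (fun y => |f y|)]

open Filter Topology Convolution ContinuousLinearMap in
lemma weak_ftc_smooth (f : E2 → ℝ) (f2 : Fin 2 → E2 → ℝ) (hf : Integrable f)
    (hf2 : ∀ i, IsWeakPartialDeriv i f (f2 i) ∧ Integrable (f2 i))
    (w : E2 → ℝ) (hw : ContDiff ℝ (⊤ : ℕ∞) w) (hc : HasCompactSupport w) (x v : E2) (a b : ℝ) :
    (∫ y, w y * f (x + b • v - y)) - (∫ y, w y * f (x + a • v - y))
      = ∫ τ in a..b, ∑ i, v i * ∫ y, w y * f2 i (x + τ • v - y) := by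
  have hcont : ∀ i, Continuous (fun z => ∫ y, w y * f2 i (z - y)) := by
    intro i
    have := hc.continuous_convolution_left (lsmul ℝ ℝ) hw.continuous (hf2 i).2.locallyIntegrable
      (μ := volume)
    exact this
  have hder : ∀ z : E2, HasFDerivAt (fun z => ∫ y, w y * f (z - y))
      ((fderiv ℝ w ⋆[(lsmul ℝ ℝ).precompL E2, volume] f) z) z := by
    intro z
    exact hc.hasFDerivAt_convolution_left (lsmul ℝ ℝ) (hw.of_le (by norm_cast)) hf.locallyIntegrable z
  have hval : ∀ z : E2, ((fderiv ℝ w ⋆[(lsmul ℝ ℝ).precompL E2, volume] f) z) v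
      = ∑ i, v i * ∫ y, w y * f2 i (z - y) := by
    intro z
    have hcd : Continuous (fderiv ℝ w) := hw.continuous_fderiv (by simp)
    have hcs : HasCompactSupport (fderiv ℝ w) := hc.fderiv (𝕜 := ℝ)
    have h1 : ((fderiv ℝ w ⋆[(lsmul ℝ ℝ).precompL E2, volume] f) z) v
        = ∫ y, fderiv ℝ w y v * f (z - y) := by
      rw [convolution_def, ContinuousLinearMap.integral_apply]
      · rfl
      · exact hcs.convolutionExists_left _ hcd hf.locallyIntegrable z
    have hi : ∀ i, (∫ y, fderiv ℝ w y (EuclideanSpace.single i 1) * f (z - y))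
        = ∫ y, w y * f2 i (z - y) := by
      intro i
      have hΦ : ContDiff ℝ (⊤ : ℕ∞) (fun y => w (z - y)) := hw.comp (contDiff_const.sub contDiff_id)
      have hΦc : HasCompactSupport (fun y => w (z - y)) :=
        hc.comp_homeomorph (Homeomorph.subLeft z)
      have := (hf2 i).1 _ hΦ hΦc
      have hfd : ∀ y, fderiv ℝ (fun y => w (z - y)) y (EuclideanSpace.single i 1)
          = - fderiv ℝ w (z - y) (EuclideanSpace.single i 1) := by
        intro y
        have hd : HasFDerivAt (fun y => w (z - y)) ((fderiv ℝ w (z - y)).comp (-(ContinuousLinearMap.id ℝ E2))) y := by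
          refine HasFDerivAt.comp y (hw.differentiable (by simp) _).hasFDerivAt ?_
          exact (hasFDerivAt_id y).const_sub z
        rw [hd.fderiv]; simp
      simp only [hfd, mul_neg, integral_neg, neg_inj] at this
      rw [← integral_sub_left_eq_self (fun y => fderiv ℝ w y (EuclideanSpace.single i 1) * f (z - y)) volume z,
        ← integral_sub_left_eq_self (fun y => w y * f2 i (z - y)) volume z]
      simp only [sub_sub_cancel]
      convert this using 2
      · ext y; ring
      · ext y; ring
    rw [h1]
    have hv : ∀ y, fderiv ℝ w y v = ∑ i, v i * fderiv ℝ w y (EuclideanSpace.single i 1) := by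
      intro y
      conv_lhs => rw [← (EuclideanSpace.basisFun (Fin 2) ℝ).sum_repr v]
      simp
    simp_rw [hv, Finset.sum_mul]
    rw [integral_finsetSum]
    · simp_rw [mul_assoc, integral_const_mul, hi]
    · intro i _
      have : Continuous fun y => fderiv ℝ w y (EuclideanSpace.single i 1) := by fun_prop
      have hcs' : HasCompactSupport fun y => fderiv ℝ w y (EuclideanSpace.single i 1) :=
        hc.fderiv_apply ℝ _
      obtain ⟨C, hC⟩ := hcs'.exists_bound_of_continuous this
      have := mul_sub_integrable hf this.aestronglyMeasurable hC z
      simp_rw [mul_assoc]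
      exact this.const_mul _
  symm
  apply intervalIntegral.integral_eq_sub_of_hasDerivAt (f := fun τ => ∫ y, w y * f (x + τ • v - y))
  · intro τ _
    rw [← hval]
    have hline : HasDerivAt (fun τ : ℝ => x + τ • v) v τ := by
      simpa using ((hasDerivAt_id τ).smul_const v).const_add x
    exact (hder (x + τ • v)).comp_hasDerivAt τ hline
  · apply Continuous.intervalIntegrable
    refine continuous_finsetSum _ fun i _ => continuous_const.mul ?_
    exact (hcont i).comp (by fun_prop)

open Filter Topology in
lemma weak_ftc (f : E2 → ℝ) (f2 : Fin 2 → E2 → ℝ) (hf : Integrable f)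
    (hf2 : ∀ i, IsWeakPartialDeriv i f (f2 i) ∧ Integrable (f2 i))
    (w : E2 → ℝ) (hw : Measurable w) (M : ℝ) (hb : ∀ x, |w x| ≤ M) (x v : E2) (a b : ℝ) :
    (∫ y, w y * f (x + b • v - y)) - (∫ y, w y * f (x + a • v - y))
      = ∫ τ in a..b, ∑ i, v i * ∫ y, w y * f2 i (x + τ • v - y) := by
  obtain ⟨W, hW1, hW2, hW3, hW4⟩ := approx_exists w hw M hb
  have key : ∀ (g : E2 → ℝ), Integrable g → ∀ z, Tendsto (fun n => ∫ y, W n y * g (z - y)) atTop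
      (𝓝 (∫ y, w y * g (z - y))) := by
    intro g hg z
    refine tendsto_integral_of_dominated_convergence (fun y => M * |g (z - y)|) ?_ ?_ ?_ ?_
    · intro n
      exact (mul_sub_integrable hg (hW1 n).continuous.aestronglyMeasurable (hW3 n) z).aestronglyMeasurable
    · exact (sub_integrable hg z).abs.const_mul M
    · intro n
      refine Eventually.of_forall fun y => ?_
      rw [norm_mul]
      exact mul_le_mul_of_nonneg_right (hW3 n y) (norm_nonneg _)
    · filter_upwards [hW4] with y hy
      exact hy.mul_const _
  have hL := (key f hf (x + b • v)).sub (key f hf (x + a • v))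
  have hcont : ∀ n i, Continuous (fun z => ∫ y, W n y * f2 i (z - y)) := by
    intro n i
    have := (hW2 n).continuous_convolution_left (ContinuousLinearMap.lsmul ℝ ℝ) (hW1 n).continuous (hf2 i).2.locallyIntegrable
      (μ := volume)
    exact this
  have hR : Tendsto (fun n => ∫ τ in a..b, ∑ i, v i * ∫ y, W n y * f2 i (x + τ • v - y)) atTop
      (𝓝 (∫ τ in a..b, ∑ i, v i * ∫ y, w y * f2 i (x + τ • v - y))) := by
    refine intervalIntegral.tendsto_integral_filter_of_dominated_convergence
      (fun _ => ∑ i, |v i| * (M * ∫ y, |f2 i y|)) ?_ ?_ ?_ ?_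
    · refine Eventually.of_forall fun n => Continuous.aestronglyMeasurable ?_
      refine continuous_finsetSum _ fun i _ => continuous_const.mul ?_
      exact (hcont n i).comp (by fun_prop)
    · refine Eventually.of_forall fun n => Eventually.of_forall fun τ _ => ?_
      refine (norm_sum_le _ _).trans (Finset.sum_le_sum fun i _ => ?_)
      rw [norm_mul]
      exact mul_le_mul_of_nonneg_left (abs_conv_le (hf2 i).2 (hW3 n) _) (norm_nonneg _)
    · exact intervalIntegrable_const
    · refine Eventually.of_forall fun τ _ => ?_
      refine tendsto_finsetSum _ fun i _ => ?_
      exact (key _ (hf2 i).2 _).const_mul _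
  refine tendsto_nhds_unique hL (hR.congr fun n => ?_)
  exact (weak_ftc_smooth f f2 hf hf2 (W n) (hW1 n) (hW2 n) x v a b).symm

lemma gauss_pos (x : E2) : 0 < Gauss x := by unfold Gauss; positivity

lemma gauss_cont : Continuous Gauss := by unfold Gauss; fun_prop

lemma exp_int {b : ℝ} (hb : 0 < b) : Integrable (fun x : E2 => Real.exp (-b * ‖x‖ ^ 2)) := by
  have h := GaussianFourier.integral_rexp_neg_mul_sq_norm (V := E2) hb
  by_contra hn
  rw [integral_undef hn] at h
  have : (0 : ℝ) < (Real.pi / b) ^ (Module.finrank ℝ E2 / 2 : ℝ) := by positivity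
  linarith

lemma gauss_int : Integrable Gauss := by
  have := (exp_int (b := 1 / 2) (by norm_num)).const_mul (2 * Real.pi)⁻¹
  refine this.congr (Filter.Eventually.of_forall fun x => ?_)
  simp only [Gauss]; congr 2; ring

lemma gauss_integral : ∫ x, Gauss x = 1 := by
  have h := GaussianFourier.integral_rexp_neg_mul_sq_norm (V := E2) (b := 1 / 2) (by norm_num)
  have h2 : ∀ x, Gauss x = (2 * Real.pi)⁻¹ * Real.exp (-(1 / 2) * ‖x‖ ^ 2) := by
    intro x; simp only [Gauss]; congr 2; ring
  simp_rw [h2]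
  rw [integral_const_mul, h]
  simp
  field_simp

lemma gauss_neg (x : E2) : Gauss (-x) = Gauss x := by simp [Gauss]

lemma gauss_le (x : E2) : Gauss x ≤ (2 * Real.pi)⁻¹ := by
  unfold Gauss
  have : Real.exp (-‖x‖ ^ 2 / 2) ≤ 1 := by
    rw [Real.exp_le_one_iff]; have := sq_nonneg ‖x‖; linarith
  have h : (0 : ℝ) < (2 * Real.pi)⁻¹ := by positivity
  nlinarith

lemma norm_mul_gauss_le (x : E2) : ‖x‖ * Gauss x ≤ (2 * Real.pi)⁻¹ * Real.exp (-(1 / 4) * ‖x‖ ^ 2) := by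
  have h1 : ‖x‖ ≤ Real.exp (1 / 4 * ‖x‖ ^ 2) := by
    have := Real.add_one_le_exp (1 / 4 * ‖x‖ ^ 2)
    nlinarith [sq_nonneg (1 - ‖x‖ / 2)]
  have h2 : Real.exp (-(1 / 4) * ‖x‖ ^ 2) = Real.exp (1 / 4 * ‖x‖ ^ 2) * Real.exp (-‖x‖ ^ 2 / 2) := by
    rw [← Real.exp_add]; congr 1; ring
  rw [h2]
  unfold Gauss
  have := mul_le_mul_of_nonneg_right h1 (gauss_pos x).le
  unfold Gauss at this
  linarith

lemma norm_mul_gauss_int : Integrable (fun x => ‖x‖ * Gauss x) := by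
  refine ((exp_int (b := 1 / 4) (by norm_num)).const_mul (2 * Real.pi)⁻¹).mono'
    (by have := gauss_cont; fun_prop) (Filter.Eventually.of_forall fun x => ?_)
  rw [Real.norm_of_nonneg (mul_nonneg (norm_nonneg _) (gauss_pos x).le)]
  exact norm_mul_gauss_le x

lemma gauss_hasFDeriv (x : E2) : HasFDerivAt Gauss (-(Gauss x) • innerSL ℝ x) x := by
  have h1 : HasFDerivAt (fun x : E2 => ‖x‖ ^ 2) (2 • innerSL ℝ x) x := (hasStrictFDerivAt_norm_sq x).hasFDerivAt
  have h2 := ((h1.neg.mul_const (1 / 2 : ℝ)).exp).const_mul (2 * Real.pi)⁻¹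
  have h3 : Gauss = fun x : E2 => (2 * Real.pi)⁻¹ * Real.exp (-‖x‖ ^ 2 * (1 / 2)) := by
    ext y; simp only [Gauss]; congr 2; ring
  rw [h3]
  refine HasFDerivAt.congr_fderiv h2 ?_
  ext v
  simp
  ring

/-- partial derivatives of the Gaussian -/
def dG (i : Fin 2) (x : E2) : ℝ := -(x i) * Gauss x

lemma gauss_fderiv (x : E2) (v : E2) : fderiv ℝ Gauss x v = - (inner ℝ x v * Gauss x) := by
  rw [(gauss_hasFDeriv x).fderiv]; simp; ring

lemma gauss_fderiv_single (x : E2) (i : Fin 2) :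
    fderiv ℝ Gauss x (EuclideanSpace.single i 1) = dG i x := by
  rw [gauss_fderiv]; simp [dG, EuclideanSpace.inner_single_right]

lemma gauss_fderiv_norm (x : E2) : ‖fderiv ℝ Gauss x‖ = ‖x‖ * Gauss x := by
  rw [(gauss_hasFDeriv x).fderiv, norm_smul, innerSL_apply_norm, norm_neg,
    Real.norm_of_nonneg (gauss_pos x).le, mul_comm]

lemma dG_cont (i : Fin 2) : Continuous (dG i) := by
  have := gauss_cont; unfold dG; fun_prop

lemma abs_coord_le (x : E2) (i : Fin 2) : |x i| ≤ ‖x‖ := by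
  simpa using PiLp.norm_apply_le x i

lemma abs_dG_le (i : Fin 2) (x : E2) : |dG i x| ≤ ‖x‖ * Gauss x := by
  rw [dG, abs_mul, abs_neg, abs_of_pos (gauss_pos x)]
  exact mul_le_mul_of_nonneg_right (abs_coord_le x i) (gauss_pos x).le

lemma dG_int (i : Fin 2) : Integrable (dG i) :=
  norm_mul_gauss_int.mono' (dG_cont i).aestronglyMeasurable
    (Filter.Eventually.of_forall fun x => abs_dG_le i x)

lemma gauss_weak (i : Fin 2) : IsWeakPartialDeriv i Gauss (dG i) := by
  intro φ hφ hc
  have h := integral_mul_fderiv_eq_neg_fderiv_mul_of_integrable (μ := (volume : Measure E2))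
    (f := Gauss) (g := φ) (v := EuclideanSpace.single i 1) ?_ ?_ ?_ ?_ ?_
  · rw [h]
    simp_rw [gauss_fderiv_single]
  · simp_rw [gauss_fderiv_single]
    obtain ⟨C, hC⟩ := hc.exists_bound_of_continuous hφ.continuous
    exact (dG_int i).mul_bdd (c := C) hφ.continuous.aestronglyMeasurable (Filter.Eventually.of_forall hC)
  · have hcd : Continuous fun x => fderiv ℝ φ x (EuclideanSpace.single i 1) := by
      have := hφ.continuous_fderiv (by simp); fun_prop
    obtain ⟨C, hC⟩ := (hc.fderiv_apply ℝ (EuclideanSpace.single i 1)).exists_bound_of_continuous hcd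
    exact gauss_int.mul_bdd (c := C) hcd.aestronglyMeasurable (Filter.Eventually.of_forall hC)
  · obtain ⟨C, hC⟩ := hc.exists_bound_of_continuous hφ.continuous
    exact gauss_int.mul_bdd (c := C) hφ.continuous.aestronglyMeasurable (Filter.Eventually.of_forall hC)
  · exact fun x _ => (gauss_hasFDeriv x).differentiableAt
  · exact fun x _ => hφ.differentiable (by simp) x

lemma weak_add {i : Fin 2} {f f' g g' : E2 → ℝ} (hf : Integrable f) (hf' : Integrable f')
    (hg : Integrable g) (hg' : Integrable g') (h : IsWeakPartialDeriv i f f')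
    (k : IsWeakPartialDeriv i g g') :
    IsWeakPartialDeriv i (fun x => f x + g x) (fun x => f' x + g' x) := by
  intro φ hφ hc
  have hcd : Continuous fun x => fderiv ℝ φ x (EuclideanSpace.single i 1) := by
    have := hφ.continuous_fderiv (by simp); fun_prop
  obtain ⟨C, hC⟩ := (hc.fderiv_apply ℝ (EuclideanSpace.single i 1)).exists_bound_of_continuous hcd
  obtain ⟨C', hC'⟩ := hc.exists_bound_of_continuous hφ.continuous
  have H1 : ∀ f : E2 → ℝ, Integrable f → Integrable (fun x => f x * fderiv ℝ φ x (EuclideanSpace.single i 1)) :=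
    fun f hf => hf.mul_bdd (c := C) hcd.aestronglyMeasurable (Filter.Eventually.of_forall hC)
  have H2 : ∀ f : E2 → ℝ, Integrable f → Integrable (fun x => f x * φ x) :=
    fun f hf => hf.mul_bdd (c := C') hφ.continuous.aestronglyMeasurable (Filter.Eventually.of_forall hC')
  simp_rw [add_mul]
  rw [integral_add (H1 f hf) (H1 g hg), integral_add (H2 _ hf') (H2 _ hg'), h φ hφ hc, k φ hφ hc]
  ring

/-- uniform integrability -/
lemma unif_int (f : E2 → ℝ) (hf : Integrable f) (η : ℝ) (hη : 0 < η) :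
    ∃ γ : ℝ, 0 < γ ∧ ∀ w : E2 → ℝ, Integrable w → (∀ x, |w x| ≤ 1) → (∫ x, |w x|) ≤ γ →
      ∀ z, |∫ y, w y * f (z - y)| ≤ η := by
  obtain ⟨g, hgc, hg1, hg2, hg3⟩ := hf.exists_hasCompactSupport_integral_sub_le (half_pos hη)
  obtain ⟨C, hC⟩ := hgc.exists_bound_of_continuous hg2
  have hC0 : 0 ≤ C := (norm_nonneg _).trans (hC 0)
  refine ⟨η / 2 / (C + 1), by positivity, fun w hw hb hγ z => ?_⟩
  have hfg : Integrable (fun y => f y - g y) := hf.sub hg3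
  have e1 : Integrable (fun y => w y * (f (z - y) - g (z - y))) :=
    mul_sub_integrable hfg hw.aestronglyMeasurable hb z
  have e2 : Integrable (fun y => w y * g (z - y)) :=
    mul_sub_integrable hg3 hw.aestronglyMeasurable hb z
  have : (fun y => w y * f (z - y)) = fun y => w y * (f (z - y) - g (z - y)) + w y * g (z - y) := by
    ext y; ring
  rw [this, integral_add e1 e2]
  have b1 := abs_conv_le (f := fun y => f y - g y) hfg hb z
  have b2 : |∫ y, w y * g (z - y)| ≤ C * (η / 2 / (C + 1)) := by
    rw [← Real.norm_eq_abs]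
    calc _ ≤ ∫ y, C * |w y| := by
          refine norm_integral_le_of_norm_le (hw.abs.const_mul C) ?_
          refine Filter.Eventually.of_forall fun t => ?_
          rw [norm_mul, mul_comm]
          exact mul_le_mul_of_nonneg_right (hC _) (abs_nonneg _)
      _ = C * ∫ y, |w y| := integral_const_mul _ _
      _ ≤ _ := mul_le_mul_of_nonneg_left hγ hC0
  have b3 : C * (η / 2 / (C + 1)) ≤ η / 2 := by
    rw [mul_div_assoc', div_le_iff₀ (by positivity)]; nlinarith
  simp only [Real.norm_eq_abs] at hg1
  calc _ ≤ _ := abs_add_le _ _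
    _ ≤ η / 2 + η / 2 := by linarith
    _ = η := by ring

/-- translation continuity in L1 for the Gaussian derivatives -/
lemma dG_trans (i : Fin 2) (η : ℝ) (hη : 0 < η) :
    ∃ T : ℝ, 0 < T ∧ ∀ h : E2, ‖h‖ ≤ T → (∫ y, |dG i (y + h) - dG i y|) ≤ η := by
  have : Filter.Tendsto (fun h : E2 => ∫ y, |dG i (y + h) - dG i y|) (nhds 0) (nhds (∫ y : E2, (0 : ℝ))) := by
    refine tendsto_integral_filter_of_dominated_convergence
      (fun y => (2 * Real.pi)⁻¹ * Real.exp (1 / 4) * Real.exp (-(1 / 8) * ‖y‖ ^ 2) + |dG i y|) ?_ ?_ ?_ ?_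
    · refine Filter.Eventually.of_forall fun h => Continuous.aestronglyMeasurable ?_
      have := dG_cont i; fun_prop
    · filter_upwards [Metric.ball_mem_nhds (0 : E2) one_pos] with h hh
      refine Filter.Eventually.of_forall fun y => ?_
      rw [Real.norm_eq_abs, abs_abs]
      refine (abs_sub _ _).trans (add_le_add ?_ le_rfl)
      refine (abs_dG_le i _).trans ((norm_mul_gauss_le _).trans ?_)
      rw [mul_assoc, ← Real.exp_add]
      refine mul_le_mul_of_nonneg_left (Real.exp_le_exp.2 ?_) (by positivity)
      have h1 : ‖h‖ < 1 := by simpa using hh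
      have h2 : ‖y‖ ≤ ‖y + h‖ + ‖h‖ := by
        calc ‖y‖ = ‖(y + h) - h‖ := by simp
          _ ≤ _ := norm_sub_le _ _
      have h3 : ‖y‖ ^ 2 ≤ 2 * ‖y + h‖ ^ 2 + 2 := by
        have : ‖y‖ ^ 2 ≤ (‖y + h‖ + 1) ^ 2 := by
          apply pow_le_pow_left₀ (norm_nonneg _); linarith
        nlinarith [sq_nonneg (‖y + h‖ - 1)]
      linarith
    · exact ((exp_int (b := 1 / 8) (by norm_num)).const_mul _).add (dG_int i).abs
    · refine Filter.Eventually.of_forall fun y => ?_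
      have hc : Continuous fun h : E2 => |dG i (y + h) - dG i y| := by
        have := dG_cont i; fun_prop
      have := hc.tendsto 0
      simpa using this
  simp only [integral_zero] at this
  have h2 := this.eventually (ge_mem_nhds hη)
  obtain ⟨T, hT, hT2⟩ := Metric.eventually_nhds_iff.1 h2
  refine ⟨T / 2, by positivity, fun h hh => hT2 ?_⟩
  rw [dist_zero_right]; linarith

lemma gauss_coord (x : E2) : Gauss x = (2 * Real.pi)⁻¹ * Real.exp (-(x 0 ^ 2 + x 1 ^ 2) / 2) := by
  unfold Gauss
  rw [EuclideanSpace.norm_sq_eq, Fin.sum_univ_two]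
  simp

/-- coordinates map -/
def cmap : E2 ≃ᵐ ℝ × ℝ := (MeasurableEquiv.toLp 2 (Fin 2 → ℝ)).symm.trans MeasurableEquiv.finTwoArrow

lemma cmap_apply (x : E2) : cmap x = (x 0, x 1) := rfl

lemma cmap_mp : MeasurePreserving cmap :=
  (PiLp.volume_preserving_ofLp (Fin 2)).trans (volume_preserving_finTwoArrow ℝ)

/-- the profile integral -/
def prof (θ : ℝ → ℝ) : ℝ := ∫ t : ℝ, (2 * Real.pi)⁻¹ * Real.exp (-(t ^ 2 + θ t ^ 2) / 2)

lemma exp_sq_int : Integrable (fun t : ℝ => Real.exp (-t ^ 2 / 2)) := by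
  have := integrable_exp_neg_mul_sq (b := 1 / 2) (by norm_num)
  refine this.congr (Filter.Eventually.of_forall fun x => ?_)
  simp only; congr 1; ring

lemma prof_int (θ : ℝ → ℝ) (hθ : Continuous θ) :
    Integrable (fun t : ℝ => (2 * Real.pi)⁻¹ * Real.exp (-(t ^ 2 + θ t ^ 2) / 2)) := by
  refine Integrable.const_mul ?_ _
  refine exp_sq_int.mono' (by fun_prop) (Filter.Eventually.of_forall fun t => ?_)
  rw [Real.norm_of_nonneg (Real.exp_pos _).le]
  apply Real.exp_le_exp.2
  have := sq_nonneg (θ t); linarith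

lemma inner_int (t a : ℝ) : ∫ r in Ioi a, r * ((2 * Real.pi)⁻¹ * Real.exp (-(t ^ 2 + r ^ 2) / 2))
    = (2 * Real.pi)⁻¹ * Real.exp (-(t ^ 2 + a ^ 2) / 2) := by
  have hd : ∀ r : ℝ, HasDerivAt (fun r => -((2 * Real.pi)⁻¹ * Real.exp (-(t ^ 2 + r ^ 2) / 2)))
      (r * ((2 * Real.pi)⁻¹ * Real.exp (-(t ^ 2 + r ^ 2) / 2))) r := by
    intro r
    have h1 : HasDerivAt (fun r : ℝ => -(t ^ 2 + r ^ 2) / 2) (-r) r := by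
      have := (((hasDerivAt_pow 2 r).const_add (t ^ 2)).neg).div_const 2
      refine HasDerivAt.congr_deriv this ?_
      simp
      ring
    have := (h1.exp.const_mul (2 * Real.pi)⁻¹).neg
    refine HasDerivAt.congr_deriv this ?_
    ring
  have ht : Filter.Tendsto (fun r => -((2 * Real.pi)⁻¹ * Real.exp (-(t ^ 2 + r ^ 2) / 2)))
      Filter.atTop (nhds (-((2 * Real.pi)⁻¹ * 0))) := by
    refine ((Real.tendsto_exp_atBot.comp ?_).const_mul _).neg
    have h : Filter.Tendsto (fun r : ℝ => (t ^ 2 + r ^ 2) / 2) Filter.atTop Filter.atTop := by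
      refine Filter.Tendsto.atTop_div_const (by norm_num) ?_
      exact Filter.tendsto_atTop_add_const_left _ _ (Filter.tendsto_pow_atTop (by norm_num))
    refine (Filter.tendsto_neg_atTop_atBot.comp h).congr fun r => ?_
    simp only [Function.comp]; ring
  have hIntg : IntegrableOn (fun r : ℝ => r * ((2 * Real.pi)⁻¹ * Real.exp (-(t ^ 2 + r ^ 2) / 2))) (Ioi a) := by
    have := (integrable_mul_exp_neg_mul_sq (b := 1 / 2) (by norm_num)).const_mul ((2 * Real.pi)⁻¹ * Real.exp (-t ^ 2 / 2))
    refine (this.congr (Filter.Eventually.of_forall fun r => ?_)).integrableOn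
    simp only
    have : Real.exp (-(t ^ 2 + r ^ 2) / 2) = Real.exp (-t ^ 2 / 2) * Real.exp (-(1 / 2) * r ^ 2) := by
      rw [← Real.exp_add]; congr 1; ring
    rw [this]; ring
  rw [integral_Ioi_of_hasDerivAt_of_tendsto (hd a).continuousAt.continuousWithinAt (fun r _ => hd r) hIntg ht]
  ring

lemma super_int (θ : ℝ → ℝ) (hθ : Continuous θ) :
    ∫ ζ in {ζ : E2 | θ (ζ 0) < ζ 1}, ζ 1 * Gauss ζ = prof θ := by
  have hm : MeasurableSet {ζ : E2 | θ (ζ 0) < ζ 1} :=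
    (isOpen_lt (by fun_prop) (by fun_prop)).measurableSet
  rw [← integral_indicator hm]
  let F : ℝ × ℝ → ℝ := {p : ℝ × ℝ | θ p.1 < p.2}.indicator
    (fun p => p.2 * ((2 * Real.pi)⁻¹ * Real.exp (-(p.1 ^ 2 + p.2 ^ 2) / 2)))
  have hF : ∀ ζ : E2, {ζ : E2 | θ (ζ 0) < ζ 1}.indicator (fun ζ => ζ 1 * Gauss ζ) ζ = F (cmap ζ) := by
    intro ζ
    simp only [F, cmap_apply, indicator, mem_ofPred_eq, gauss_coord]
  have hFint : Integrable F := by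
    rw [← cmap_mp.integrable_comp_emb cmap.measurableEmbedding]
    have : F ∘ cmap = {ζ : E2 | θ (ζ 0) < ζ 1}.indicator (fun ζ => ζ 1 * Gauss ζ) := by
      ext ζ; rw [hF]; rfl
    rw [this]
    refine Integrable.indicator ?_ hm
    refine (dG_int 1).neg.congr (Filter.Eventually.of_forall fun x => ?_)
    simp [dG]
  simp_rw [hF]
  rw [cmap_mp.integral_comp cmap.measurableEmbedding F]
  rw [Measure.volume_eq_prod] at hFint ⊢
  rw [integral_prod _ hFint, prof]
  congr 1; ext t
  rw [← inner_int t (θ t), ← integral_indicator measurableSet_Ioi]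
  rfl

/-- wedge profile -/
def WL (L d : ℝ) : ℝ := prof (fun t => d + L * |t|)

lemma prof_mono {θ₁ θ₂ : ℝ → ℝ} (h1 : Continuous θ₁) (h2 : Continuous θ₂) (h : ∀ t, θ₁ t ^ 2 ≤ θ₂ t ^ 2) :
    prof θ₂ ≤ prof θ₁ := by
  refine integral_mono (prof_int _ h2) (prof_int _ h1) fun t => ?_
  simp only
  have := h t
  refine mul_le_mul_of_nonneg_left (Real.exp_le_exp.2 ?_) (by positivity)
  linarith

lemma WL_scale (L L' d : ℝ) (hd : 0 ≤ d) (hL' : 0 < L') (h : L' ≤ L) : L' * WL L' d ≤ L * WL L d := by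
  have hL : 0 < L := hL'.trans_le h
  have hθ : Continuous (fun t => d + L' * |t|) := by fun_prop
  have hθL : Continuous (fun t => d + L * |t|) := by fun_prop
  set c := L / L' with hc
  have hc1 : 1 ≤ c := by rw [hc, le_div_iff₀ hL']; linarith
  have hcL : L' * c = L := by rw [hc]; field_simp
  have h1 := Measure.integral_comp_mul_left (fun t : ℝ => (2 * Real.pi)⁻¹ * Real.exp (-(t ^ 2 + (d + L' * |t|) ^ 2) / 2)) c
  have h2 : ∫ t : ℝ, (2 * Real.pi)⁻¹ * Real.exp (-((c * t) ^ 2 + (d + L' * |c * t|) ^ 2) / 2) ≤ WL L d := by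
    refine integral_mono ?_ (prof_int _ hθL) fun t => ?_
    · exact (prof_int _ hθ).comp_mul_left' (by positivity)
    · simp only
      refine mul_le_mul_of_nonneg_left (Real.exp_le_exp.2 ?_) (by positivity)
      have e1 : t ^ 2 ≤ (c * t) ^ 2 := by
        rw [mul_pow]; exact le_mul_of_one_le_left (sq_nonneg t) (one_le_pow₀ hc1)
      have e2 : L' * |c * t| = L * |t| := by
        rw [abs_mul, abs_of_pos (by linarith : 0 < c), ← mul_assoc, hcL]
      rw [e2]; linarith
  rw [h1, abs_of_pos (by positivity)] at h2
  simp only [smul_eq_mul] at h2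
  change c⁻¹ * WL L' d ≤ WL L d at h2
  have := mul_le_mul_of_nonneg_left h2 hL.le
  have e : L * (c⁻¹ * WL L' d) = L' * WL L' d := by rw [← hcL]; field_simp
  linarith

lemma WL_le_half (L d : ℝ) : WL L d ≤ 1 / 2 := by
  have h1 : WL L d ≤ ∫ t : ℝ, (2 * Real.pi)⁻¹ * Real.exp (-(1/2) * t ^ 2) := by
    refine integral_mono (prof_int _ (by fun_prop)) ((integrable_exp_neg_mul_sq (by norm_num)).const_mul _) fun t => ?_
    simp only
    gcongr
    have := sq_nonneg (d + L * |t|); linarith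
  rw [integral_const_mul, integral_gaussian] at h1
  refine h1.trans ?_
  have hpi := Real.pi_gt_three
  have h2 : Real.sqrt (Real.pi / (1 / 2)) ≤ Real.pi := by
    rw [Real.sqrt_le_left (by positivity)]; nlinarith
  rw [inv_mul_le_iff₀ (by positivity)]
  linarith

/-- comparison of an arbitrary Lipschitz profile with the wedge -/
lemma prof_ge_wedge (θ : ℝ → ℝ) (hθ : Continuous θ) (L : ℝ) (hL : 0 ≤ L) (Y0 b d : ℝ) (hb : 0 ≤ b) (hd : 0 ≤ d)
    (hbd : Y0 ^ 2 + b ^ 2 = d ^ 2) (h : ∀ t, |θ t| ≤ b + L * |t - Y0|) : WL L d ≤ prof θ := by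
  let f : ℝ → ℝ := fun τ => (2 * Real.pi)⁻¹ * Real.exp (-((τ + Y0) ^ 2 + (b + L * |τ|) ^ 2) / 2)
  have hg := prof_int (fun t => b + L * |t - Y0|) (by fun_prop)
  have hfi : Integrable f := by
    have := hg.comp_add_right Y0
    simpa [f] using this
  have hf1 : ∫ τ, f τ ≤ prof θ := by
    have e : ∫ τ, f τ = prof (fun t => b + L * |t - Y0|) := by
      rw [prof, ← integral_add_right_eq_self (fun t => (2 * Real.pi)⁻¹ * Real.exp (-(t ^ 2 + (b + L * |t - Y0|) ^ 2) / 2)) Y0]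
      simp [f]
    rw [e]
    refine prof_mono hθ (by fun_prop) fun t => ?_
    rw [← sq_abs (θ t)]
    exact pow_le_pow_left₀ (abs_nonneg _) (h t) 2
  have hbd' : b ≤ d := by
    apply le_of_sq_le_sq _ hd; nlinarith [sq_nonneg Y0]
  have hneg : ∫ τ, f (-τ) = ∫ τ, f τ := integral_neg_eq_self f volume
  have hW : WL L d ≤ ∫ τ, (f τ + f (-τ)) / 2 := by
    refine integral_mono (prof_int _ (by fun_prop)) ((hfi.add hfi.comp_neg).div_const 2) fun t => ?_
    simp only [f, abs_neg]
    have e1 : Real.exp (-((t + Y0) ^ 2 + (b + L * |t|) ^ 2) / 2)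
       = Real.exp (-(d ^ 2 + t ^ 2 + 2 * b * L * |t| + L ^ 2 * |t| ^ 2) / 2) * Real.exp (-(Y0 * t)) := by
      rw [← Real.exp_add]; congr 1; rw [← hbd]; ring
    have e2 : Real.exp (-((-t + Y0) ^ 2 + (b + L * |t|) ^ 2) / 2)
       = Real.exp (-(d ^ 2 + t ^ 2 + 2 * b * L * |t| + L ^ 2 * |t| ^ 2) / 2) * Real.exp (Y0 * t) := by
      rw [← Real.exp_add]; congr 1; rw [← hbd]; ring
    have e3 : Real.exp (-(t ^ 2 + (d + L * |t|) ^ 2) / 2)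
       ≤ Real.exp (-(d ^ 2 + t ^ 2 + 2 * b * L * |t| + L ^ 2 * |t| ^ 2) / 2) := by
      apply Real.exp_le_exp.2
      have : b * (L * |t|) ≤ d * (L * |t|) := mul_le_mul_of_nonneg_right hbd' (by positivity)
      nlinarith
    have e4 : 2 ≤ Real.exp (-(Y0 * t)) + Real.exp (Y0 * t) := by
      have := Real.add_one_le_exp (-(Y0 * t)); have := Real.add_one_le_exp (Y0 * t); linarith
    rw [e1, e2]
    have hE := Real.exp_pos (-(d ^ 2 + t ^ 2 + 2 * b * L * |t| + L ^ 2 * |t| ^ 2) / 2)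
    have hP : 0 < (2 * Real.pi)⁻¹ := by positivity
    set E := Real.exp (-(d ^ 2 + t ^ 2 + 2 * b * L * |t| + L ^ 2 * |t| ^ 2) / 2)
    have e5 : E ≤ E * ((Real.exp (-(Y0 * t)) + Real.exp (Y0 * t)) / 2) := by nlinarith
    have e6 := mul_le_mul_of_nonneg_left (e3.trans e5) hP.le
    linarith
  rw [integral_div, integral_add hfi hfi.comp_neg, hneg] at hW
  linarith

lemma norm_sq_coord (x : E2) : ‖x‖ ^ 2 = x 0 ^ 2 + x 1 ^ 2 := by
  rw [EuclideanSpace.norm_sq_eq, Fin.sum_univ_two]; simp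

/-- orthonormal frame at `x` with vertical direction `(p, q)` -/
def frame (p q : ℝ) (h : p ^ 2 + q ^ 2 = 1) (x : E2) : E2 ≃ᵢ E2 where
  toFun y := !₂[q * (y 0 - x 0) - p * (y 1 - x 1), p * (y 0 - x 0) + q * (y 1 - x 1)]
  invFun z := !₂[x 0 + z 0 * q + z 1 * p, x 1 - z 0 * p + z 1 * q]
  left_inv y := by
    ext i; fin_cases i
    · simp; linear_combination (y 0 - x 0) * h
    · simp; linear_combination (y 1 - x 1) * h
  right_inv z := by
    ext i; fin_cases i
    · simp; linear_combination (z 0) * h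
    · simp; linear_combination (z 1) * h
  isometry_toFun := by
    refine Isometry.of_dist_eq fun y z => ?_
    rw [dist_eq_norm, dist_eq_norm]
    rw [← sq_eq_sq₀ (norm_nonneg _) (norm_nonneg _), norm_sq_coord, norm_sq_coord]
    simp
    linear_combination ((y 0 - z 0) ^ 2 + (y 1 - z 1) ^ 2) * h

lemma frame_zero (p q : ℝ) (h : p ^ 2 + q ^ 2 = 1) (x y : E2) :
    (frame p q h x y) 0 = q * (y 0 - x 0) - p * (y 1 - x 1) := rfl

lemma frame_one (p q : ℝ) (h : p ^ 2 + q ^ 2 = 1) (x y : E2) :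
    (frame p q h x y) 1 = p * (y 0 - x 0) + q * (y 1 - x 1) := rfl

lemma frame_self (p q : ℝ) (h : p ^ 2 + q ^ 2 = 1) (x : E2) : frame p q h x x = 0 := by
  ext i; fin_cases i
  · simp [frame_zero]
  · simp [frame_one]

lemma iso_coord_lt (A : E2 ≃ᵢ E2) (x : E2) (hA : A x = 0) {r : ℝ} {w : E2} (hw : w ∈ ball x r) (i : Fin 2) :
    |(A w) i| < r := by
  refine (abs_coord_le _ i).trans_lt ?_
  rw [← dist_zero_right, ← hA, A.isometry.dist_eq]
  exact hw

lemma lip_of_cone (D : Set E2) (hD : IsOpen D) (r L : ℝ) (hr : 0 < r) (hL : 0 < L) (x : E2)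
    (hx : x ∈ frontier D) (A : E2 ≃ᵢ E2) (hA : A x = 0)
    (hc : ∀ w ∈ ball x r, ∀ y ∈ ball x r, w ∈ D → L * |(A w) 0 - (A y) 0| < (A w) 1 - (A y) 1 → y ∈ D) :
    ∃ φ : ℝ → ℝ, LipschitzWith (Real.toNNReal L) φ ∧ φ 0 = 0 ∧
      ∀ y ∈ ball x r, (y ∈ D ↔ (A y) 1 < φ ((A y) 0)) := by
  have hxc : x ∈ closure D := hx.1
  have hxD : x ∉ D := by
    rw [hD.frontier_eq] at hx; exact hx.2
  let S : ℝ → Set ℝ := fun t => (fun w : E2 => (A w) 1 - L * |t - (A w) 0|) '' (D ∩ ball x r)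
  have hne : (D ∩ ball x r).Nonempty := by
    obtain ⟨w, hw, hw2⟩ := Metric.mem_closure_iff.1 hxc r hr
    exact ⟨w, hw, by rw [mem_ball, dist_comm]; exact hw2⟩
  have hbdd : ∀ t, BddAbove (S t) := by
    intro t
    refine ⟨r, ?_⟩
    rintro _ ⟨w, hw, rfl⟩
    have := (abs_lt.1 (iso_coord_lt A x hA hw.2 1)).2
    have : 0 ≤ L * |t - (A w) 0| := by positivity
    simp only; linarith
  let φ : ℝ → ℝ := fun t => sSup (S t)
  have hlip : LipschitzWith (Real.toNNReal L) φ := by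
    refine LipschitzWith.of_le_add_mul _ fun t t' => ?_
    refine csSup_le (hne.image _) ?_
    rintro _ ⟨w, hw, rfl⟩
    have h1 : (A w) 1 - L * |t' - (A w) 0| ≤ φ t' := le_csSup (hbdd t') ⟨w, hw, rfl⟩
    rw [Real.coe_toNNReal _ hL.le, Real.dist_eq]
    have h2 : |t' - (A w) 0| ≤ |t - t'| + |t - (A w) 0| := by
      rw [abs_sub_comm t t']; exact abs_sub_le _ _ _
    simp only
    nlinarith
  have hiff : ∀ y ∈ ball x r, (A y) 1 < φ ((A y) 0) → y ∈ D := by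
    intro y hy hlt
    obtain ⟨_, ⟨w, hw, rfl⟩, h2⟩ := exists_lt_of_lt_csSup (hne.image _) hlt
    refine hc w hw.2 y hy hw.1 ?_
    rw [abs_sub_comm]
    simp only at h2
    linarith
  refine ⟨φ, hlip, ?_, fun y hy => ⟨fun hyD => ?_, hiff y hy⟩⟩
  · apply le_antisymm
    · by_contra hlt
      push Not at hlt
      refine hxD (hiff x (mem_ball_self hr) ?_)
      rw [hA]; simpa using hlt
    · refine le_of_forall_pos_le_add fun ε hε => ?_
      obtain ⟨w, hw, hw2⟩ := Metric.mem_closure_iff.1 hxc (min r (ε / (1 + L))) (by positivity)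
      have hwb : w ∈ ball x (min r (ε / (1 + L))) := by rw [mem_ball, dist_comm]; exact hw2
      have hwr : w ∈ ball x r := ball_subset_ball (min_le_left _ _) hwb
      have hwe : w ∈ ball x (ε / (1 + L)) := ball_subset_ball (min_le_right _ _) hwb
      have h1 : (A w) 1 - L * |0 - (A w) 0| ≤ φ 0 := le_csSup (hbdd 0) ⟨w, ⟨hw, hwr⟩, rfl⟩
      have h2 := (abs_lt.1 (iso_coord_lt A x hA hwe 1)).1
      have h3 := iso_coord_lt A x hA hwe 0
      rw [zero_sub, abs_neg] at h1
      have h4 : ε / (1 + L) + L * (ε / (1 + L)) = ε := by field_simp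
      nlinarith
  · -- y in D: move up slightly
    have hnb : D ∩ ball x r ∈ nhds y := (hD.inter isOpen_ball).mem_nhds ⟨hyD, hy⟩
    obtain ⟨ε, hε, hsub⟩ := Metric.mem_nhds_iff.1 hnb
    let w : E2 := A.symm (A y + EuclideanSpace.single 1 (ε / 2))
    have hw : w ∈ D ∩ ball x r := by
      apply hsub
      rw [mem_ball, ← A.isometry.dist_eq]
      simp only [w, IsometryEquiv.apply_symm_apply, dist_self_add_left]
      simp
      rw [abs_of_pos hε]; linarith
    have h1 : (A w) 1 - L * |(A y) 0 - (A w) 0| ≤ φ ((A y) 0) := le_csSup (hbdd _) ⟨w, hw, rfl⟩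
    simp [w] at h1
    linarith

/-- the lens function -/
def lensQ (κ : ℝ) (y : E2) : ℝ := y 0 ^ 2 + y 1 ^ 2 + 2 * κ * |y 0|

/-- the lens -/
def lens (κ c : ℝ) : Set E2 := {y | lensQ κ y < c}

lemma lensQ_cont (κ : ℝ) : Continuous (lensQ κ) := by unfold lensQ; fun_prop

lemma lens_open (κ c : ℝ) : IsOpen (lens κ c) := isOpen_lt (lensQ_cont κ) continuous_const

lemma lens_bdd (κ c : ℝ) (hκ : 0 ≤ κ) : Bornology.IsBounded (lens κ c) := by
  refine (Metric.isBounded_ball (x := (0 : E2)) (r := |c| + 1)).subset fun y hy => ?_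
  have hy' : y 0 ^ 2 + y 1 ^ 2 + 2 * κ * |y 0| < c := hy
  rw [mem_ball, dist_zero_right]
  have h1 := norm_sq_coord y
  have : 0 ≤ 2 * κ * |y 0| := by positivity
  by_contra hn
  push Not at hn
  nlinarith [le_abs_self c, abs_nonneg c]

lemma lens_frontier (κ c : ℝ) {x : E2} (hx : x ∈ frontier (lens κ c)) : lensQ κ x = c :=
  frontier_lt_subset_eq (lensQ_cont κ) continuous_const hx

/-- cone condition near the tips -/
lemma lens_caseA (r L κ c : ℝ) (hr : 0 < r) (hL : 0 < L) (hκ : 0 ≤ κ) (x : E2) (σ : ℝ) (hσ : 0 ^ 2 + σ ^ 2 = 1)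
    (hx0 : |x 0| ≤ r) (hx1 : 2 * r + κ ≤ L * (σ * x 1 - r)) :
    ∀ w ∈ ball x r, ∀ y ∈ ball x r, w ∈ lens κ c →
      L * |(frame 0 σ hσ x w) 0 - (frame 0 σ hσ x y) 0| < (frame 0 σ hσ x w) 1 - (frame 0 σ hσ x y) 1 →
      y ∈ lens κ c := by
  intro w hw y hy hwD hlt
  have hσ2 : |σ| = 1 := by
    have : σ ^ 2 = 1 := by simpa using hσ
    rw [← sq_eq_sq₀ (abs_nonneg _) zero_le_one, sq_abs, this]; norm_num
  simp only [frame_zero, frame_one] at hlt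
  have e0 : |σ * (w 0 - x 0) - 0 * (w 1 - x 1) - (σ * (y 0 - x 0) - 0 * (y 1 - x 1))| = |w 0 - y 0| := by
    rw [show σ * (w 0 - x 0) - 0 * (w 1 - x 1) - (σ * (y 0 - x 0) - 0 * (y 1 - x 1)) = σ * (w 0 - y 0) by ring,
      abs_mul, hσ2, one_mul]
  rw [e0] at hlt
  have hb : ∀ z ∈ ball x r, ∀ i, |z i - x i| < r := by
    intro z hz i
    have := abs_coord_le (z - x) i
    rw [mem_ball, dist_eq_norm] at hz
    simp only [PiLp.sub_apply] at this
    linarith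
  have hwD' : w 0 ^ 2 + w 1 ^ 2 + 2 * κ * |w 0| < c := hwD
  change y 0 ^ 2 + y 1 ^ 2 + 2 * κ * |y 0| < c
  have hw1 : -r ≤ σ * (w 1 - x 1) := by
    have := hb w hw 1
    have h2 : |σ * (w 1 - x 1)| < r := by rw [abs_mul, hσ2, one_mul]; exact this
    linarith [(abs_lt.1 h2).1]
  have hy1 : -r ≤ σ * (y 1 - x 1) := by
    have := hb y hy 1
    have h2 : |σ * (y 1 - x 1)| < r := by rw [abs_mul, hσ2, one_mul]; exact this
    linarith [(abs_lt.1 h2).1]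
  have hs0 : |w 0 + y 0| ≤ 4 * r := by
    have h1 := abs_lt.1 (hb w hw 0)
    have h2 := abs_lt.1 (hb y hy 0)
    have h3 := abs_le.1 hx0
    rw [abs_le]; constructor <;> linarith [h1.1, h1.2, h2.1, h2.2, h3.1, h3.2]
  set V := σ * (w 1 - y 1) with hV
  have hV' : L * |w 0 - y 0| < V := by rw [hV]; linarith
  set Sg := σ * (w 1 + y 1) with hSg
  have hSg' : 2 * (σ * x 1 - r) ≤ Sg := by rw [hSg]; nlinarith
  have hprod : (w 1 - y 1) * (w 1 + y 1) = V * Sg := by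
    have : σ ^ 2 = 1 := by simpa using hσ
    rw [hV, hSg]; linear_combination -(w 1 - y 1) * (w 1 + y 1) * this
  have h5 : |y 0| - |w 0| ≤ |w 0 - y 0| := by rw [abs_sub_comm]; exact abs_sub_abs_le_abs_sub _ _
  have h6 : -((w 0 - y 0) * (w 0 + y 0)) ≤ |w 0 - y 0| * (4 * r) := by
    calc _ ≤ |(w 0 - y 0) * (w 0 + y 0)| := neg_le_abs _
      _ = |w 0 - y 0| * |w 0 + y 0| := abs_mul _ _
      _ ≤ _ := by gcongr
  have hn := abs_nonneg (w 0 - y 0)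
  have h7 : 0 ≤ σ * x 1 - r := by
    by_contra hneg
    push Not at hneg
    nlinarith
  have h8 : |w 0 - y 0| * (4 * r + 2 * κ) ≤ V * Sg := by
    calc |w 0 - y 0| * (4 * r + 2 * κ) ≤ |w 0 - y 0| * (2 * (L * (σ * x 1 - r))) := by
          gcongr; linarith
      _ = (L * |w 0 - y 0|) * (2 * (σ * x 1 - r)) := by ring
      _ ≤ V * Sg := by
          apply mul_le_mul hV'.le hSg' (by linarith)
          exact le_trans (by positivity) hV'.le
  have h9 : 2 * κ * (|y 0| - |w 0|) ≤ 2 * κ * |w 0 - y 0| := by gcongr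
  nlinarith

/-- cone condition away from the tips -/
lemma lens_caseB (r L κ ρ : ℝ) (hr : 0 < r) (hL : 0 < L) (hρ : r + r / L ≤ ρ) (x : E2) (σ p q : ℝ)
    (hpq : p ^ 2 + q ^ 2 = 1) (hp : ρ * p = x 0 + σ * κ) (hq : ρ * q = x 1)
    (hσ : σ ^ 2 = 1) (hx0 : r ≤ σ * x 0) :
    ∀ w ∈ ball x r, ∀ y ∈ ball x r, w ∈ lens κ (ρ ^ 2 - κ ^ 2) →
      L * |(frame p q hpq x w) 0 - (frame p q hpq x y) 0| < (frame p q hpq x w) 1 - (frame p q hpq x y) 1 →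
      y ∈ lens κ (ρ ^ 2 - κ ^ 2) := by
  intro w hw y hy hwD hlt
  have hσ2 : |σ| = 1 := by
    rw [← sq_eq_sq₀ (abs_nonneg _) zero_le_one, sq_abs, hσ]; norm_num
  have habs : ∀ z ∈ ball x r, |z 0| = σ * z 0 := by
    intro z hz
    have h1 := abs_coord_le (z - x) 0
    rw [mem_ball, dist_eq_norm] at hz
    simp only [PiLp.sub_apply] at h1
    have h2 : |σ * (z 0 - x 0)| < r := by rw [abs_mul, hσ2, one_mul]; linarith
    have h3 := (abs_lt.1 h2).1
    have h4 : 0 ≤ σ * z 0 := by nlinarith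
    calc |z 0| = |σ * z 0| := by rw [abs_mul, hσ2, one_mul]
      _ = _ := abs_of_nonneg h4
  have hQ : ∀ z ∈ ball x r, lensQ κ z = (frame p q hpq x z) 0 ^ 2 + ((frame p q hpq x z) 1 + ρ) ^ 2 - κ ^ 2 := by
    intro z hz
    rw [lensQ, habs z hz, frame_zero, frame_one]
    have e1 : (p * (z 0 - x 0) + q * (z 1 - x 1) + ρ) = p * (z 0 + σ * κ) + q * z 1 := by
      linear_combination -ρ * hpq + p * hp + q * hq
    have e2 : q * (z 0 - x 0) - p * (z 1 - x 1) = q * (z 0 + σ * κ) - p * z 1 := by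
      linear_combination q * hp - p * hq
    rw [e1, e2]
    linear_combination -((z 0 + σ * κ) ^ 2 + z 1 ^ 2) * hpq - κ ^ 2 * hσ
  have hbd := fun z hz i => abs_lt.1 (iso_coord_lt (frame p q hpq x) x (frame_self p q hpq x) (r := r) (w := z) hz i)
  change lensQ κ w < _ at hwD
  change lensQ κ y < _
  rw [hQ w hw] at hwD
  rw [hQ y hy]
  set w0 := (frame p q hpq x w) 0
  set w1 := (frame p q hpq x w) 1
  set y0 := (frame p q hpq x y) 0
  set y1 := (frame p q hpq x y) 1
  have a1 := hbd w hw 0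
  have a2 := hbd w hw 1
  have a3 := hbd y hy 0
  have a4 := hbd y hy 1
  have hn := abs_nonneg (w0 - y0)
  have h6 : -((w0 - y0) * (w0 + y0)) ≤ |w0 - y0| * (2 * r) := by
    calc _ ≤ |(w0 - y0) * (w0 + y0)| := neg_le_abs _
      _ = |w0 - y0| * |w0 + y0| := abs_mul _ _
      _ ≤ _ := by
        gcongr
        rw [abs_le]; constructor <;> linarith [a1.1, a1.2, a3.1, a3.2]
  have h7 : |w0 - y0| * (2 * r) ≤ (w1 - y1) * (2 * (r / L)) := by
    have : |w0 - y0| * (2 * r) = (L * |w0 - y0|) * (2 * (r / L)) := by field_simp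
    rw [this]
    exact mul_le_mul_of_nonneg_right hlt.le (by positivity)
  have h8 : 0 ≤ w1 - y1 := le_trans (by positivity) hlt.le
  have h9 : (w1 - y1) * (2 * (r / L)) ≤ (w1 - y1) * (w1 + y1 + 2 * ρ) := by
    refine mul_le_mul_of_nonneg_left ?_ h8
    linarith [a2.1, a4.1]
  nlinarith

lemma lens_apex (κ β : ℝ) (hκ : 0 ≤ κ) (hβ : 0 < β) : !₂[(0:ℝ), β] ∈ frontier (lens κ (β ^ 2)) := by
  rw [(lens_open _ _).frontier_eq]
  refine ⟨?_, ?_⟩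
  · rw [Metric.mem_closure_iff]
    intro ε hε
    set t := min (ε / 2) β with ht
    have ht0 : 0 < t := by positivity
    have ht1 : t ≤ ε / 2 := min_le_left _ _
    have ht2 : t ≤ β := min_le_right _ _
    refine ⟨!₂[0, β - t], ?_, ?_⟩
    · change lensQ _ _ < _
      simp [lensQ]
      nlinarith
    · rw [dist_eq_norm, EuclideanSpace.norm_eq]
      simp [Fin.sum_univ_two]
      rw [Real.sqrt_sq ht0.le]
      linarith
  · intro h
    change lensQ _ _ < _ at h
    simp [lensQ] at h

lemma lens_sub (κ β L' : ℝ) (hL' : 0 < L') (hβ : 0 < β) (hκ : κ = L' * β) {w : E2}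
    (hw : w ∈ lens κ (β ^ 2)) : w 1 < β - L' * |w 0| := by
  change w 0 ^ 2 + w 1 ^ 2 + 2 * κ * |w 0| < _ at hw
  subst hκ
  by_contra hn
  push Not at hn
  have h0 := abs_nonneg (w 0)
  rcases le_or_gt 0 (β - L' * |w 0|) with h | h
  · have : (β - L' * |w 0|) ^ 2 ≤ w 1 ^ 2 := by gcongr
    nlinarith [sq_nonneg (L' * |w 0|), sq_nonneg (w 0)]
  · nlinarith [sq_nonneg (w 1), sq_nonneg (w 0)]

lemma lens_lip (r L L' : ℝ) (hr : 0 < r) (hL' : 0 < L') (hLL : L' < L) :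
    ∃ β > 0, IsLipDomain r L (lens (L' * β) (β ^ 2)) ∧ 2 * r + L' * β ≤ L * (β - r) := by
  have hL : 0 < L := hL'.trans hLL
  set k := L' / L with hk
  have hk0 : 0 < k := by positivity
  have hk1 : k < 1 := by rw [hk, div_lt_one hL]; exact hLL
  set m := r + 2 * r / L with hm
  have hm0 : 0 < m := by positivity
  have hlead : 0 < 1 - k ^ 2 := by nlinarith
  set β := 1 + (r + r / L) + (2 * k * m + 2 * L' * r + m ^ 2 + r ^ 2) / (1 - k ^ 2) with hβ
  have hβ1 : 1 ≤ β := by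
    have : 0 ≤ (r + r / L) + (2 * k * m + 2 * L' * r + m ^ 2 + r ^ 2) / (1 - k ^ 2) := by positivity
    linarith
  have hβ2 : r + r / L ≤ β := by
    have : 0 ≤ (2 * k * m + 2 * L' * r + m ^ 2 + r ^ 2) / (1 - k ^ 2) := by positivity
    linarith
  have hβ3 : (2 * k * m + 2 * L' * r + m ^ 2 + r ^ 2) ≤ (1 - k ^ 2) * β := by
    rw [mul_comm (1 - k ^ 2), ← div_le_iff₀ hlead]
    have : 0 ≤ 1 + (r + r / L) := by positivity
    linarith
  clear_value β
  have hβ0 : 0 < β := by linarith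
  refine ⟨β, hβ0, ?_, ?_⟩
  rotate_left
  · have hx1 : k * β + m ≤ β := by
      refine abs_le_of_sq_le_sq' ?_ hβ0.le |>.2
      have e3 : (2 * k * m + 2 * L' * r + m ^ 2 + r ^ 2) * β ≤ (1 - k ^ 2) * β * β := by gcongr
      have e4 : m ^ 2 ≤ (m ^ 2) * β := le_mul_of_one_le_right (by positivity) hβ1
      have e5 : 0 ≤ 2 * L' * r * β + r ^ 2 * β := by positivity
      nlinarith
    have : L * (k * β + m - r) = L' * β + 2 * r := by rw [hk, hm]; field_simp; ring
    nlinarith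
  intro x hx
  have hQ := lens_frontier _ _ hx
  rw [lensQ] at hQ
  rcases le_or_gt (|x 0|) r with h0 | h0
  · -- case A
    obtain ⟨σ, hσ, hσx⟩ : ∃ σ : ℝ, 0 ^ 2 + σ ^ 2 = 1 ∧ σ * x 1 = |x 1| := by
      rcases le_or_gt 0 (x 1) with h | h
      · exact ⟨1, by norm_num, by rw [abs_of_nonneg h]; ring⟩
      · exact ⟨-1, by norm_num, by rw [abs_of_neg h]; ring⟩
    have hx1 : k * β + m ≤ |x 1| := by
      refine abs_le_of_sq_le_sq' ?_ (abs_nonneg _) |>.2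
      rw [sq_abs]
      have e1 : x 0 ^ 2 ≤ r ^ 2 := by rw [← sq_abs (x 0)]; gcongr
      have e2 : 2 * (L' * β) * |x 0| ≤ 2 * (L' * β) * r := by gcongr
      have e3 : (2 * k * m + 2 * L' * r + m ^ 2 + r ^ 2) * β ≤ (1 - k ^ 2) * β * β := by gcongr
      have e4 : m ^ 2 + r ^ 2 ≤ (m ^ 2 + r ^ 2) * β := le_mul_of_one_le_right (by positivity) hβ1
      nlinarith
    have hc := lens_caseA r L (L' * β) (β ^ 2) hr hL (by positivity) x σ hσ h0 (by
      rw [hσx]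
      have : L * (k * β + m - r) = L' * β + 2 * r := by rw [hk, hm]; field_simp; ring
      nlinarith)
    obtain ⟨φ, h1, h2, h3⟩ := lip_of_cone _ (lens_open _ _) r L hr hL x hx _ (frame_self 0 σ hσ x) hc
    exact ⟨_, φ, frame_self 0 σ hσ x, h1, h2, h3⟩
  · obtain ⟨σ, hσ, hσx⟩ : ∃ σ : ℝ, σ ^ 2 = 1 ∧ σ * x 0 = |x 0| := by
      rcases le_or_gt 0 (x 0) with h | h
      · exact ⟨1, by norm_num, by rw [abs_of_nonneg h]; ring⟩
      · exact ⟨-1, by norm_num, by rw [abs_of_neg h]; ring⟩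
    set ρ := Real.sqrt (β ^ 2 + (L' * β) ^ 2) with hρ
    have hρ2 : ρ ^ 2 = β ^ 2 + (L' * β) ^ 2 := Real.sq_sqrt (by positivity)
    have hρβ : β ≤ ρ := Real.le_sqrt_of_sq_le (by nlinarith [sq_nonneg (L' * β)])
    have hρ0 : 0 < ρ := by linarith
    have hpq : ((x 0 + σ * (L' * β)) / ρ) ^ 2 + (x 1 / ρ) ^ 2 = 1 := by
      rw [div_pow, div_pow, ← add_div, div_eq_one_iff_eq (by positivity), hρ2]
      rw [← hσx] at hQ
      linear_combination hQ + (L' * β) ^ 2 * hσ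
    have hc := lens_caseB r L (L' * β) ρ hr hL (by linarith) x σ _ _ hpq (by field_simp) (by field_simp) hσ
      (by rw [hσx]; exact h0.le)
    have e : ρ ^ 2 - (L' * β) ^ 2 = β ^ 2 := by rw [hρ2]; ring
    rw [e] at hc
    obtain ⟨φ, h1, h2, h3⟩ := lip_of_cone _ (lens_open _ _) r L hr hL x hx _ (frame_self _ _ hpq x) hc
    exact ⟨_, φ, frame_self _ _ hpq x, h1, h2, h3⟩

lemma conv_dG_diff (w : E2 → ℝ) (hw : Measurable w) (hb : ∀ x, |w x| ≤ 1) (i : Fin 2) (z h : E2) :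
    |(∫ y, w y * dG i (z + h - y)) - ∫ y, w y * dG i (z - y)| ≤ ∫ y, |dG i (y + h) - dG i y| := by
  have hf : Integrable (fun y => dG i (y + h) - dG i y) := ((dG_int i).comp_add_right h).sub (dG_int i)
  have := abs_conv_le hf hb z
  rw [one_mul] at this
  refine le_trans (le_of_eq ?_) this
  congr 1
  rw [← integral_sub (mul_sub_integrable (dG_int i) hw.aestronglyMeasurable hb _)
    (mul_sub_integrable (dG_int i) hw.aestronglyMeasurable hb _)]
  congr 1; ext y
  rw [show z + h - y = z - y + h by abel]; ring

lemma conv_dG_cont (w : E2 → ℝ) (hw : Measurable w) (hb : ∀ x, |w x| ≤ 1) (i : Fin 2) :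
    Continuous (fun z => ∫ y, w y * dG i (z - y)) := by
  rw [Metric.continuous_iff]
  intro z ε hε
  obtain ⟨T, hT, hT2⟩ := dG_trans i (ε / 2) (by positivity)
  refine ⟨T, hT, fun a ha => ?_⟩
  rw [Real.dist_eq]
  have := conv_dG_diff w hw hb i z (a - z)
  rw [add_sub_cancel] at this
  have h2 := hT2 (a - z) (by rw [← dist_eq_norm]; exact ha.le)
  linarith

lemma conv_fderiv (D : Set E2) (hD : IsOpen D) (y v : E2) (a : ℝ) (ha : 0 < a)
    (h : a ≤ fderiv ℝ (convK D Gauss) y v) :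
    fderiv ℝ (convK D Gauss) y v = ∑ i, v i * ∫ w, D.indicator (fun _ => (1 : ℝ)) w * dG i (y - w) := by
  have hdiff : DifferentiableAt ℝ (convK D Gauss) y := by
    by_contra hn
    rw [fderiv_zero_of_not_differentiableAt hn] at h
    simp at h; linarith
  have hm : Measurable (D.indicator (fun _ => (1 : ℝ))) := measurable_const.indicator hD.measurableSet
  have hb : ∀ x, |D.indicator (fun _ => (1 : ℝ)) x| ≤ 1 := by
    intro x; by_cases hx : x ∈ D <;> simp [hx]
  have hline : HasDerivAt (fun t : ℝ => y + t • v) v 0 := by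
    have := ((hasDerivAt_id (0:ℝ)).smul_const v).const_add y
    simpa using this
  have h1 : HasDerivAt (fun t : ℝ => convK D Gauss (y + t • v)) (fderiv ℝ (convK D Gauss) y v) 0 := by
    have h0 : HasFDerivAt (convK D Gauss) (fderiv ℝ (convK D Gauss) y) (y + (0:ℝ) • v) := by
      simpa using hdiff.hasFDerivAt
    exact h0.comp_hasDerivAt (0:ℝ) hline
  set F : ℝ → ℝ := fun τ => ∑ i, v i * ∫ w, D.indicator (fun _ => (1 : ℝ)) w * dG i (y + τ • v - w) with hF
  have hFc : Continuous F := by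
    refine continuous_finsetSum _ fun i _ => continuous_const.mul ?_
    exact (conv_dG_cont _ hm hb i).comp (by fun_prop : Continuous fun τ : ℝ => y + τ • v)
  have h2 : HasDerivAt (fun t : ℝ => convK D Gauss (y + t • v)) (F 0) 0 := by
    have e : (fun t : ℝ => convK D Gauss (y + t • v)) = fun t => convK D Gauss y + ∫ τ in (0:ℝ)..t, F τ := by
      ext t
      have := weak_ftc Gauss dG gauss_int (fun i => ⟨gauss_weak i, dG_int i⟩) _ hm 1 hb y v 0 t
      rw [hF, ← this]
      simp [convK]
    rw [e]
    exact (intervalIntegral.integral_hasDerivAt_right (hFc.intervalIntegrable _ _)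
      hFc.stronglyMeasurable.stronglyMeasurableAtFilter hFc.continuousAt).const_add _
  rw [h1.unique h2, hF]
  simp

lemma a1_le_WL (L a₁ δ δ₁ R₀ : ℝ) (hL : 0 < L) (hR₀ : 1 ≤ R₀) (ha₁ : 0 < a₁) (hδ₁ : 0 < δ₁)
    (hgrad : ∀ D : Set E2, IsOpen D → Bornology.IsBounded D → IsLipDomain R₀ L D →
      ∀ x ∈ frontier D, ∀ (A : E2 ≃ᵢ E2) (φ : ℝ → ℝ),
        A x = 0 → LipschitzWith (Real.toNNReal L) φ → φ 0 = 0 →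
        (∀ y ∈ ball x R₀, (y ∈ D ↔ (A y) 1 < φ ((A y) 0))) →
        ∀ y : E2, |(A y) 0| ≤ δ₁ * R₀ →
          φ ((A y) 0) - δ * R₀ ≤ (A y) 1 → (A y) 1 ≤ φ ((A y) 0) + δ * R₀ →
          a₁ ≤ fderiv ℝ (convK D Gauss) y
            (A.symm (A y - EuclideanSpace.single (1 : Fin 2) (1 : ℝ)) - y))
    (d : ℝ) (hd : 0 ≤ d) (hd2 : d ≤ δ * R₀) : a₁ ≤ WL L d := by
  have key : ∀ L' : ℝ, 0 < L' → L' < L → a₁ ≤ WL L' d := by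
    intro L' hL' hLL
    obtain ⟨β, hβ, hlip, hcone⟩ := lens_lip R₀ L L' (by linarith) hL' hLL
    set D := lens (L' * β) (β ^ 2) with hDdef
    have hop : IsOpen D := lens_open _ _
    set x : E2 := !₂[(0:ℝ), β] with hxdef
    have hx : x ∈ frontier D := lens_apex _ _ (by positivity) hβ
    have hσ : (0:ℝ) ^ 2 + 1 ^ 2 = 1 := by norm_num
    have hc := lens_caseA R₀ L (L' * β) (β ^ 2) (by linarith) hL (by positivity) x 1 hσ
      (by simp [hxdef]; linarith) (by simpa [hxdef] using hcone)
    obtain ⟨φ, h1, h2, h3⟩ := lip_of_cone D hop R₀ L (by linarith) hL x hx _ (frame_self 0 1 hσ x) hc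
    set y : E2 := !₂[(0:ℝ), β + d] with hydef
    have hy0 : (frame 0 1 hσ x y) 0 = 0 := by rw [frame_zero]; simp [hxdef, hydef]
    have hy1 : (frame 0 1 hσ x y) 1 = d := by rw [frame_one]; simp [hxdef, hydef]
    have hg := hgrad D hop (lens_bdd _ _ (by positivity)) hlip x hx _ φ (frame_self 0 1 hσ x) h1 h2 h3 y
      (by rw [hy0]; simp; positivity) (by rw [hy0, hy1, h2]; linarith) (by rw [hy0, hy1, h2]; linarith)
    rw [conv_fderiv D hop y _ a₁ ha₁ hg, Fin.sum_univ_two] at hg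
    have hv : (frame 0 1 hσ x).symm (frame 0 1 hσ x y - EuclideanSpace.single (1 : Fin 2) (1 : ℝ))
        = !₂[(0:ℝ), β + d - 1] := by
      rw [← (frame 0 1 hσ x).injective.eq_iff, IsometryEquiv.apply_symm_apply]
      ext i; fin_cases i
      · simp [frame_zero, hxdef, hydef]
      · simp [frame_one, hxdef, hydef]; ring
    rw [hv] at hg
    simp only [hydef, PiLp.sub_apply] at hg
    simp at hg
    rw [← integral_neg] at hg
    refine hg.trans ?_
    rw [WL, ← super_int _ (by fun_prop)]
    have hmS : MeasurableSet {ζ : E2 | d + L' * |ζ 0| < ζ 1} :=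
      (isOpen_lt (by fun_prop) (by fun_prop)).measurableSet
    rw [← integral_indicator hmS]
    have e : (∫ w, -(D.indicator (fun _ => (1 : ℝ)) w * dG 1 (!₂[(0:ℝ), β + d] - w)))
        = ∫ ζ, -(D.indicator (fun _ => (1 : ℝ)) (!₂[(0:ℝ), β + d] - ζ) * dG 1 ζ) := by
      rw [← integral_sub_left_eq_self _ volume !₂[(0:ℝ), β + d]]
      simp
    rw [e]
    have hgi : Integrable (fun ζ : E2 => ζ 1 * Gauss ζ) := by
      have := (dG_int 1).neg
      refine this.congr (Filter.Eventually.of_forall fun ζ => ?_)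
      simp [dG]
    have hm : Measurable (D.indicator (fun _ => (1 : ℝ))) := measurable_const.indicator hop.measurableSet
    have hb : ∀ x, |D.indicator (fun _ => (1 : ℝ)) x| ≤ 1 := by
      intro x; by_cases hx : x ∈ D <;> simp [hx]
    refine integral_mono ?_ (hgi.indicator hmS) ?_
    · have := ((mul_sub_integrable (dG_int 1) hm.aestronglyMeasurable hb !₂[(0:ℝ), β + d]).comp_sub_left
        !₂[(0:ℝ), β + d]).neg
      simpa using this
    · intro ζ
      by_cases hζ : (!₂[(0:ℝ), β + d] - ζ) ∈ D
      · have h5 := lens_sub (L' * β) β L' hL' hβ rfl hζ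
        simp at h5
        have h6 : ζ ∈ {ζ : E2 | d + L' * |ζ 0| < ζ 1} := by
          change d + L' * |ζ 0| < ζ 1; linarith
        simp only [indicator_of_mem h6, indicator_of_mem hζ, dG]
        linarith
      · simp only [indicator_of_notMem hζ, zero_mul, neg_zero]
        refine indicator_nonneg ?_ _
        intro ζ hζ
        change d + L' * |ζ 0| < ζ 1 at hζ
        have : 0 ≤ L' * |ζ 0| := by positivity
        exact mul_nonneg (by linarith) (gauss_pos ζ).le
  have key2 : ∀ L' : ℝ, 0 < L' → L' < L → L' * a₁ ≤ L * WL L d := by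
    intro L' h1 h2
    exact (mul_le_mul_of_nonneg_left (key L' h1 h2) h1.le).trans (WL_scale L L' d hd h1 h2.le)
  by_contra hn
  push Not at hn
  have hW : 0 < WL L d := by
    have := key2 (L / 2) (by linarith) (by linarith)
    by_contra hc
    push Not at hc
    nlinarith [mul_pos hL ha₁]
  have := key2 (L * (WL L d + a₁) / (2 * a₁)) (by positivity) (by
    rw [div_lt_iff₀ (by positivity)]
    nlinarith)
  have e : L * (WL L d + a₁) / (2 * a₁) * a₁ = L * (WL L d + a₁) / 2 := by field_simp
  rw [e] at this
  nlinarith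

lemma ind_meas {D : Set E2} (hD : IsOpen D) : Measurable (D.indicator (fun _ => (1 : ℝ))) :=
  measurable_const.indicator hD.measurableSet

lemma ind_abs_le (D : Set E2) (x : E2) : |D.indicator (fun _ => (1 : ℝ)) x| ≤ 1 := by
  by_cases hx : x ∈ D <;> simp [hx]

lemma zg_int : Integrable (fun ζ : E2 => ζ 1 * Gauss ζ) := by
  have := (dG_int 1).neg
  refine this.congr (Filter.Eventually.of_forall fun ζ => ?_)
  simp [dG]

lemma grad_lower (L a₁ R₀ d : ℝ) (hL : 0 < L) (D : Set E2) (hD : IsOpen D)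
    (y z : E2) (A : E2 ≃ᵢ E2) (φ : ℝ → ℝ) (hA : A z = 0) (hφ : LipschitzWith (Real.toNNReal L) φ)
    (hφ0 : φ 0 = 0) (hgr : ∀ y ∈ ball z R₀, (y ∈ D ↔ (A y) 1 < φ ((A y) 0)))
    (hdist : dist y z = d) (hd : d ≤ R₀ / 2) (hW : a₁ ≤ WL L d)
    (htail : ∫ x in (ball (0 : E2) (R₀ / 2))ᶜ, ‖fderiv ℝ Gauss x‖ ≤ a₁ / 12) :
    ∃ v : E2, ‖v‖ = 1 ∧
      11 / 12 * a₁ ≤ ∑ i, v i * ∫ w, D.indicator (fun _ => (1 : ℝ)) w * dG i (y - w) := by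
  set ℓ : E2 ≃ₗᵢ[ℝ] E2 := A.toRealAffineIsometryEquiv.linearIsometryEquiv with hℓ
  have hAl : ∀ w, A w = ℓ (w - z) := by
    intro w
    have := A.toRealAffineIsometryEquiv.map_vsub w z
    simp only [vsub_eq_sub] at this
    rw [hℓ, this]
    change A w = A w - A z
    rw [hA, sub_zero]
  set e₂ : E2 := EuclideanSpace.single (1 : Fin 2) (1 : ℝ) with he
  have hm := ind_meas hD
  have hb := ind_abs_le D
  refine ⟨-ℓ.symm e₂, by simp [he], ?_⟩
  set Y := A y with hY
  set χ : E2 → ℝ := D.indicator (fun _ => (1 : ℝ)) with hχ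
  have e1 : ∑ i, (-ℓ.symm e₂) i * ∫ w, χ w * dG i (y - w)
      = ∫ ζ, χ (y - ℓ.symm ζ) * (ζ 1 * Gauss ζ) := by
    calc ∑ i, (-ℓ.symm e₂) i * ∫ w, χ w * dG i (y - w)
        = ∫ w, ∑ i, (-ℓ.symm e₂) i * (χ w * dG i (y - w)) := by
          rw [integral_finsetSum]
          · simp only [integral_const_mul]
          · intro i _
            exact (mul_sub_integrable (dG_int i) hm.aestronglyMeasurable hb y).const_mul _
      _ = ∫ w, χ w * ((ℓ (y - w)) 1 * Gauss (ℓ (y - w))) := by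
          congr 1; ext w
          have h1 : inner ℝ (y - w) (ℓ.symm e₂) = (ℓ (y - w)) 1 := by
            rw [← ℓ.inner_map_map, ℓ.apply_symm_apply, he, EuclideanSpace.inner_single_right]; simp
          have h2 : inner ℝ (y - w) (ℓ.symm e₂) = (y - w) 0 * (ℓ.symm e₂) 0 + (y - w) 1 * (ℓ.symm e₂) 1 := by
            rw [PiLp.inner_apply, Fin.sum_univ_two]; simp [mul_comm]
          have h3 : Gauss (ℓ (y - w)) = Gauss (y - w) := by unfold Gauss; rw [ℓ.norm_map]
          rw [← h1, h2, h3, Fin.sum_univ_two]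
          simp only [dG, PiLp.neg_apply]
          ring
      _ = ∫ w, χ (y - w) * ((ℓ w) 1 * Gauss (ℓ w)) := by
          rw [← integral_sub_left_eq_self _ volume y]; simp
      _ = _ := by
          have := (ℓ.symm.measurePreserving).integral_comp ℓ.symm.toHomeomorph.measurableEmbedding
            (fun w => χ (y - w) * ((ℓ w) 1 * Gauss (ℓ w)))
          rw [← this]; simp
  rw [e1]
  set θ : ℝ → ℝ := fun t => Y 1 - φ (Y 0 - t) with hθ
  have hφc : Continuous φ := hφ.continuous
  have hθc : Continuous θ := by rw [hθ]; fun_prop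
  set S : Set E2 := {ζ : E2 | θ (ζ 0) < ζ 1} with hS
  have hmS : MeasurableSet S := (isOpen_lt (by fun_prop) (by fun_prop)).measurableSet
  have hprof : WL L d ≤ prof θ := by
    have hd0 : 0 ≤ d := by rw [← hdist]; exact dist_nonneg
    refine prof_ge_wedge θ hθc L hL.le (Y 0) |Y 1| d (abs_nonneg _) hd0 ?_ ?_
    · have : ‖Y‖ = d := by rw [← dist_zero_right, ← hA, hY, A.isometry.dist_eq, hdist]
      rw [sq_abs, ← this, norm_sq_coord]
    · intro t
      have h1 := hφ.dist_le_mul (Y 0 - t) 0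
      rw [hφ0, Real.coe_toNNReal _ hL.le, Real.dist_eq, Real.dist_eq, sub_zero, sub_zero, abs_sub_comm] at h1
      calc |θ t| ≤ |Y 1| + |φ (Y 0 - t)| := abs_sub _ _
        _ ≤ _ := by gcongr
  rw [← super_int θ hθc, ← integral_indicator hmS] at hprof
  have hmB : MeasurableSet (ball (0 : E2) (R₀ / 2))ᶜ := measurableSet_ball.compl
  simp only [gauss_fderiv_norm] at htail
  rw [← integral_indicator hmB] at htail
  have hI1 : Integrable (S.indicator fun ζ : E2 => ζ 1 * Gauss ζ) := zg_int.indicator hmS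
  have hI2 : Integrable ((ball (0 : E2) (R₀ / 2))ᶜ.indicator fun ζ : E2 => ‖ζ‖ * Gauss ζ) :=
    norm_mul_gauss_int.indicator hmB
  have hI3 : Integrable (fun ζ => χ (y - ℓ.symm ζ) * (ζ 1 * Gauss ζ)) := by
    refine zg_int.bdd_mul (c := 1) ?_ (Filter.Eventually.of_forall fun ζ => hb _)
    exact (hm.comp (by fun_prop)).aestronglyMeasurable
  have hmain : (∫ ζ, (S.indicator (fun ζ : E2 => ζ 1 * Gauss ζ) ζ
      - (ball (0 : E2) (R₀ / 2))ᶜ.indicator (fun ζ : E2 => ‖ζ‖ * Gauss ζ) ζ))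
      ≤ ∫ ζ, χ (y - ℓ.symm ζ) * (ζ 1 * Gauss ζ) := by
    refine integral_mono (hI1.sub hI2) hI3 fun ζ => ?_
    have hF : |ζ 1 * Gauss ζ| ≤ ‖ζ‖ * Gauss ζ := by
      rw [abs_mul, abs_of_pos (gauss_pos ζ)]
      exact mul_le_mul_of_nonneg_right (abs_coord_le _ _) (gauss_pos ζ).le
    have hF' := abs_le.1 hF
    have hF0 := (abs_nonneg _).trans hF
    by_cases hζ : ζ ∈ ball (0 : E2) (R₀ / 2)
    · have hζ' : ζ ∉ (ball (0 : E2) (R₀ / 2))ᶜ := by simpa using hζ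
      simp only [indicator_of_notMem hζ', sub_zero]
      have hwb : y - ℓ.symm ζ ∈ ball z R₀ := by
        rw [mem_ball]
        rw [mem_ball, dist_zero_right] at hζ
        calc dist (y - ℓ.symm ζ) z ≤ dist (y - ℓ.symm ζ) y + dist y z := dist_triangle _ _ _
          _ = ‖ζ‖ + d := by rw [hdist, dist_eq_norm]; simp
          _ < R₀ := by linarith
      have hAw : A (y - ℓ.symm ζ) = Y - ζ := by
        rw [hAl, hY, hAl, show y - ℓ.symm ζ - z = (y - z) - ℓ.symm ζ by abel, map_sub, ℓ.apply_symm_apply]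
      have hiff := hgr _ hwb
      rw [hAw] at hiff
      simp only [PiLp.sub_apply] at hiff
      have hiff2 : y - ℓ.symm ζ ∈ D ↔ ζ ∈ S := by
        rw [hiff, hS]
        change _ ↔ Y 1 - φ (Y 0 - ζ 0) < ζ 1
        constructor <;> intro h <;> linarith
      by_cases hs : ζ ∈ S
      · simp [hχ, indicator_of_mem hs, indicator_of_mem (hiff2.2 hs)]
      · simp [hχ, indicator_of_notMem hs, indicator_of_notMem (fun h => hs (hiff2.1 h))]
    · have hζ' : ζ ∈ (ball (0 : E2) (R₀ / 2))ᶜ := hζ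
      simp only [indicator_of_mem hζ']
      by_cases hs : ζ ∈ S <;> by_cases hs2 : y - ℓ.symm ζ ∈ D <;>
        simp only [hχ, indicator_of_mem, indicator_of_notMem, hs, hs2, not_false_eq_true, one_mul, zero_mul] <;>
        linarith [hF'.1, hF'.2]
  rw [integral_sub hI1 hI2] at hmain
  linarith

lemma pre_frontier {t s : Set E2} (ht : IsPreconnected t) (h1 : (t ∩ s).Nonempty) (h2 : (t ∩ sᶜ).Nonempty) :
    (t ∩ frontier s).Nonempty := by
  by_contra hn
  have hno : ∀ x ∈ t, x ∉ frontier s := fun x hx hx2 => hn ⟨x, hx, hx2⟩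
  have key := ht (interior s) (closure s)ᶜ isOpen_interior isClosed_closure.isOpen_compl ?_ ?_ ?_
  · obtain ⟨x, _, hx2, hx3⟩ := key
    exact hx3 (subset_closure (interior_subset hx2))
  · intro x hx
    by_contra hc
    simp only [mem_union, mem_compl_iff, not_or, not_not] at hc
    exact hno x hx ⟨hc.2, hc.1⟩
  · obtain ⟨x, hx, hxs⟩ := h1
    refine ⟨x, hx, ?_⟩
    by_contra hc
    exact hno x hx ⟨subset_closure hxs, hc⟩
  · obtain ⟨x, hx, hxs⟩ := h2
    refine ⟨x, hx, fun hc => ?_⟩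
    exact hno x hx ⟨hc, fun h => hxs (interior_subset h)⟩

lemma convK_sub (D : Set E2) (y : E2) :
    convK D Gauss y = ∫ ζ, D.indicator (fun _ => (1 : ℝ)) (y - ζ) * Gauss ζ := by
  unfold convK
  rw [← integral_sub_left_eq_self _ volume y]; simp

lemma core_dir (L a₁ δ δ₁ m₁ R₀ htil : ℝ) (hL : 0 < L) (hδ : 0 < δ) (hm₁2 : m₁ ≤ 1)
    (hR₀ : 1 ≤ R₀) (ha₁ : 0 < a₁) (hδ₁ : 0 < δ₁) (hhtil2 : htil ≤ 1 / 24)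
    (hloc : ∀ D : Set E2, IsOpen D → Bornology.IsBounded D → IsLipDomain R₀ L D →
      ∀ x : E2, htil < convK D Gauss x → convK D Gauss x < 1 - htil →
        Metric.infDist x (frontier D) ≤ m₁ * δ * R₀)
    (hgrad : ∀ D : Set E2, IsOpen D → Bornology.IsBounded D → IsLipDomain R₀ L D →
      ∀ x ∈ frontier D, ∀ (A : E2 ≃ᵢ E2) (φ : ℝ → ℝ),
        A x = 0 → LipschitzWith (Real.toNNReal L) φ → φ 0 = 0 →
        (∀ y ∈ ball x R₀, (y ∈ D ↔ (A y) 1 < φ ((A y) 0))) →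
        ∀ y : E2, |(A y) 0| ≤ δ₁ * R₀ →
          φ ((A y) 0) - δ * R₀ ≤ (A y) 1 → (A y) 1 ≤ φ ((A y) 0) + δ * R₀ →
          a₁ ≤ fderiv ℝ (convK D Gauss) y
            (A.symm (A y - EuclideanSpace.single (1 : Fin 2) (1 : ℝ)) - y))
    (htail : ∫ x in (ball (0 : E2) (R₀ / 2))ᶜ, ‖fderiv ℝ Gauss x‖ ≤ a₁ / 12)
    (D : Set E2) (hD : IsOpen D) (hDb : Bornology.IsBounded D) (hlip : IsLipDomain R₀ L D) (y : E2)
    (hP1 : 1 / 2 ≤ convK D Gauss y) (hP2 : convK D Gauss y ≤ 9 / 10) :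
    ∃ v : E2, ‖v‖ = 1 ∧
      11 / 12 * a₁ ≤ ∑ i, v i * ∫ w, D.indicator (fun _ => (1 : ℝ)) w * dG i (y - w) := by
  have hWL := a1_le_WL L a₁ δ δ₁ R₀ hL hR₀ ha₁ hδ₁ hgrad
  have ha2 : a₁ ≤ 1 / 2 := (hWL 0 le_rfl (by positivity)).trans (WL_le_half L 0)
  have hm := ind_meas hD
  have hb := ind_abs_le D
  have hne : (frontier D).Nonempty := by
    rw [nonempty_iff_ne_empty]
    intro h
    rw [frontier_eq_empty_iff] at h
    rcases h with h | h
    · subst h; simp [convK] at hP1; linarith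
    · subst h; exact NormedSpace.unbounded_univ ℝ E2 hDb
  have hcpt : IsCompact (frontier D) :=
    Metric.isCompact_of_isClosed_isBounded isClosed_frontier (hDb.closure.subset frontier_subset_closure)
  obtain ⟨z, hz, hzd⟩ := hcpt.exists_infDist_eq_dist hne y
  have hd1 := hloc D hD hDb hlip y (by linarith) (by linarith)
  have hd2 : dist y z ≤ δ * R₀ := by
    rw [← hzd]; refine hd1.trans ?_
    have : m₁ * (δ * R₀) ≤ 1 * (δ * R₀) := by gcongr
    linarith
  have hd3 : dist y z ≤ R₀ / 2 := by
    by_contra hn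
    push Not at hn
    have hmB : MeasurableSet (ball (0 : E2) (R₀ / 2))ᶜ := measurableSet_ball.compl
    have htl : ∫ x in (ball (0 : E2) (R₀ / 2))ᶜ, Gauss x ≤ 1 / 12 := by
      simp only [gauss_fderiv_norm] at htail
      have : ∫ x in (ball (0 : E2) (R₀ / 2))ᶜ, Gauss x ≤ ∫ x in (ball (0 : E2) (R₀ / 2))ᶜ, 2 * (‖x‖ * Gauss x) := by
        refine setIntegral_mono_on gauss_int.integrableOn (norm_mul_gauss_int.const_mul 2).integrableOn hmB ?_
        intro x hx
        have hx' : R₀ / 2 ≤ ‖x‖ := by simpa using hx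
        have := gauss_pos x
        nlinarith
      rw [integral_const_mul] at this
      linarith
    rw [← integral_indicator hmB] at htl
    have hI2 : Integrable ((ball (0 : E2) (R₀ / 2))ᶜ.indicator Gauss) := gauss_int.indicator hmB
    have hI3 : Integrable (fun ζ => D.indicator (fun _ => (1 : ℝ)) (y - ζ) * Gauss ζ) := by
      refine gauss_int.bdd_mul (c := 1) ?_ (Filter.Eventually.of_forall fun ζ => hb _)
      exact (hm.comp (by fun_prop)).aestronglyMeasurable
    have hdisj : ¬ (ball y (R₀ / 2) ∩ frontier D).Nonempty := by
      rintro ⟨w, hw, hw2⟩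
      have := infDist_le_dist_of_mem (x := y) hw2
      rw [mem_ball, dist_comm] at hw
      linarith
    have hpre : IsPreconnected (ball y (R₀ / 2)) := (convex_ball y _).isPreconnected
    have hmem : ∀ ζ ∈ ball (0 : E2) (R₀ / 2), y - ζ ∈ ball y (R₀ / 2) := by
      intro ζ hζ
      rw [mem_ball, dist_eq_norm]; simpa using hζ
    rw [convK_sub] at hP1 hP2
    by_cases hex : (ball y (R₀ / 2) ∩ D).Nonempty
    · have hall : ∀ w ∈ ball y (R₀ / 2), w ∈ D := by
        intro w hw
        by_contra hwD
        exact hdisj (pre_frontier hpre hex ⟨w, hw, hwD⟩)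
      have : (∫ ζ, (Gauss ζ - (ball (0 : E2) (R₀ / 2))ᶜ.indicator Gauss ζ))
          ≤ ∫ ζ, D.indicator (fun _ => (1 : ℝ)) (y - ζ) * Gauss ζ := by
        refine integral_mono (gauss_int.sub hI2) hI3 fun ζ => ?_
        have := gauss_pos ζ
        by_cases hζ : ζ ∈ ball (0 : E2) (R₀ / 2)
        · have hζ' : ζ ∉ (ball (0 : E2) (R₀ / 2))ᶜ := by simpa using hζ
          simp only [indicator_of_notMem hζ', indicator_of_mem (hall _ (hmem ζ hζ))]; linarith
        · have hζ' : ζ ∈ (ball (0 : E2) (R₀ / 2))ᶜ := hζ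
          simp only [indicator_of_mem hζ', sub_self]
          exact mul_nonneg (indicator_nonneg (fun _ _ => zero_le_one) _) this.le
      rw [integral_sub gauss_int hI2, gauss_integral] at this
      linarith
    · have : ∫ ζ, D.indicator (fun _ => (1 : ℝ)) (y - ζ) * Gauss ζ
          ≤ ∫ ζ, (ball (0 : E2) (R₀ / 2))ᶜ.indicator Gauss ζ := by
        refine integral_mono hI3 hI2 fun ζ => ?_
        have := gauss_pos ζ
        by_cases hζ : ζ ∈ ball (0 : E2) (R₀ / 2)
        · have hζ' : ζ ∉ (ball (0 : E2) (R₀ / 2))ᶜ := by simpa using hζ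
          have : y - ζ ∉ D := fun h => hex ⟨_, hmem ζ hζ, h⟩
          simp only [indicator_of_notMem hζ', indicator_of_notMem this]; linarith
        · have hζ' : ζ ∈ (ball (0 : E2) (R₀ / 2))ᶜ := hζ
          simp only [indicator_of_mem hζ']
          have := (abs_le.1 (hb (y - ζ))).2
          nlinarith
      linarith
  obtain ⟨A, φ, h1, h2, h3, h4⟩ := hlip z hz
  exact grad_lower L a₁ R₀ _ hL D hD y z A φ h1 h2 h3 h4 rfl hd3 (hWL _ dist_nonneg hd2) htail

lemma conv_cont (f w : E2 → ℝ) (hf : Integrable f) (hw : Measurable w) (M : ℝ) (hb : ∀ x, |w x| ≤ M) :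
    Continuous (fun z => ∫ y, w y * f (z - y)) := by
  have hM : 0 ≤ M := (abs_nonneg _).trans (hb 0)
  have hli : LocallyIntegrable w volume := by
    rw [locallyIntegrable_iff]
    intro k hk
    exact Measure.integrableOn_of_bounded (M := M) hk.measure_lt_top.ne hw.aestronglyMeasurable
      (Filter.Eventually.of_forall hb)
  refine continuous_of_uniform_approx_of_continuous fun U hU => ?_
  obtain ⟨ε, hε, hεU⟩ := Metric.mem_uniformity_dist.1 hU
  obtain ⟨g, hgc, hg1, hg2, hg3⟩ := hf.exists_hasCompactSupport_integral_sub_le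
    (ε := ε / 2 / (M + 1)) (by positivity)
  refine ⟨fun z => ∫ y, w y * g (z - y), ?_, fun z => hεU ?_⟩
  · exact hgc.continuous_convolution_right (ContinuousLinearMap.mul ℝ ℝ) hli hg2
  · rw [Real.dist_eq, ← integral_sub (mul_sub_integrable hf hw.aestronglyMeasurable hb z)
      (mul_sub_integrable hg3 hw.aestronglyMeasurable hb z)]
    have b1 := abs_conv_le (f := fun y => f y - g y) (hf.sub hg3) hb z
    simp only [Real.norm_eq_abs] at hg1
    simp only [mul_sub] at b1
    calc _ ≤ _ := b1
      _ ≤ M * (ε / 2 / (M + 1)) := by gcongr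
      _ ≤ ε / 2 := by rw [mul_div_assoc', div_le_iff₀ (by positivity)]; nlinarith
      _ < ε := by linarith

/-- L1 modulus of translation for functions with weak derivatives -/
lemma l1_trans (f : E2 → ℝ) (f2 : Fin 2 → E2 → ℝ) (hf : Integrable f)
    (hf2 : ∀ i, IsWeakPartialDeriv i f (f2 i) ∧ Integrable (f2 i)) (x v : E2) (hv : ‖v‖ = 1) (a b : ℝ) :
    ∫ y, |f (x + b • v - y) - f (x + a • v - y)| ≤ |b - a| * ∑ i, ∫ y, |f2 i y| := by
  set g : E2 → ℝ := fun y => f (x + b • v - y) - f (x + a • v - y) with hg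
  have hgi : Integrable g := (sub_integrable hf _).sub (sub_integrable hf _)
  set g' := hgi.1.mk g with hg'
  have hg'm : Measurable g' := hgi.1.stronglyMeasurable_mk.measurable
  set w : E2 → ℝ := fun y => if 0 ≤ g' y then 1 else -1 with hw
  have hwm : Measurable w := Measurable.ite (measurableSet_le measurable_const hg'm) measurable_const measurable_const
  have hwb : ∀ y, |w y| ≤ 1 := by
    intro y; by_cases h : 0 ≤ g' y <;> simp [hw, h]
  have e1 : ∫ y, |g y| = ∫ y, w y * g y := by
    refine integral_congr_ae ?_
    filter_upwards [hgi.1.ae_eq_mk] with y hy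
    have hy' : g y = g' y := hy
    rw [hy', hw]
    by_cases h : 0 ≤ g' y
    · simp [h]
    · simp only [h, if_false]; push Not at h; rw [abs_of_neg h]; ring
  have e2 : ∫ y, w y * g y = ∫ τ in a..b, ∑ i, v i * ∫ y, w y * f2 i (x + τ • v - y) := by
    rw [← weak_ftc f f2 hf hf2 w hwm 1 hwb x v a b, ← integral_sub
      (mul_sub_integrable hf hwm.aestronglyMeasurable hwb _) (mul_sub_integrable hf hwm.aestronglyMeasurable hwb _)]
    congr 1; ext y; rw [hg]; ring
  rw [e1, e2]
  refine (le_abs_self _).trans ?_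
  rw [← Real.norm_eq_abs, mul_comm]
  refine intervalIntegral.norm_integral_le_of_norm_le_const fun τ _ => ?_
  refine (norm_sum_le _ _).trans (Finset.sum_le_sum fun i _ => ?_)
  rw [Real.norm_eq_abs, abs_mul]
  have h1 := abs_coord_le v i
  have h2 := abs_conv_le (hf2 i).2 hwb (x + τ • v)
  rw [hv] at h1
  calc |v i| * _ ≤ 1 * (1 * ∫ y, |f2 i y|) := by gcongr
    _ = _ := by ring

/-- the bilinear form -/
def Tj (j b : E2 → ℝ) (ξ : E2) : ℝ := ∫ η, j (ξ - η) * b η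

/-- the bilinear form -/
def Qj (j a b : E2 → ℝ) : ℝ := ∫ ξ, a ξ * Tj j b ξ


lemma jb_int {j : E2 → ℝ} {ε : ℝ} (hj : Continuous j) (hjb : ∀ z, |j z| ≤ ε)
    {b : E2 → ℝ} (hb : Integrable b) (ξ : E2) : Integrable (fun η => j (ξ - η) * b η) :=
  hb.bdd_mul (c := ε) (by fun_prop) (Filter.Eventually.of_forall fun η => hjb _)

lemma Tj_le {j : E2 → ℝ} {ε : ℝ} (hj : Continuous j) (hjb : ∀ z, |j z| ≤ ε)
    {b : E2 → ℝ} (hb : Integrable b) (ξ : E2) : |Tj j b ξ| ≤ ε * ∫ η, |b η| := by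
  rw [← Real.norm_eq_abs, Tj, ← integral_const_mul]
  refine norm_integral_le_of_norm_le (hb.abs.const_mul ε) (Filter.Eventually.of_forall fun t => ?_)
  rw [norm_mul, Real.norm_eq_abs, Real.norm_eq_abs]
  exact mul_le_mul_of_nonneg_right (hjb _) (abs_nonneg _)

lemma Tj_meas {j : E2 → ℝ} {ε : ℝ} (hj : Continuous j) (hjb : ∀ z, |j z| ≤ ε)
    {b : E2 → ℝ} (hb : Integrable b) : AEStronglyMeasurable (Tj j b) volume := by
  have : AEStronglyMeasurable (fun p : E2 × E2 => j (p.1 - p.2) * b p.2) (volume.prod volume) := by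
    refine AEStronglyMeasurable.mul (Continuous.aestronglyMeasurable (by fun_prop)) ?_
    exact hb.1.comp_snd
  exact this.integral_prod_right'

lemma aT_int {j : E2 → ℝ} {ε : ℝ} (hj : Continuous j) (hjb : ∀ z, |j z| ≤ ε)
    {a b : E2 → ℝ} (ha : Integrable a) (hb : Integrable b) : Integrable (fun ξ => a ξ * Tj j b ξ) :=
  ha.mul_bdd (c := ε * ∫ η, |b η|) (Tj_meas hj hjb hb) (Filter.Eventually.of_forall fun ξ => Tj_le hj hjb hb ξ)

lemma Qj_le {j : E2 → ℝ} {ε : ℝ} (hj : Continuous j) (hjb : ∀ z, |j z| ≤ ε)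
    {a b : E2 → ℝ} (ha : Integrable a) (hb : Integrable b) :
    |Qj j a b| ≤ ε * (∫ ξ, |a ξ|) * ∫ η, |b η| := by
  rw [← Real.norm_eq_abs, Qj]
  have : ε * (∫ ξ, |a ξ|) * ∫ η, |b η| = ∫ ξ, |a ξ| * (ε * ∫ η, |b η|) := by
    rw [integral_mul_const]; ring
  rw [this]
  refine norm_integral_le_of_norm_le (ha.abs.mul_const _) (Filter.Eventually.of_forall fun t => ?_)
  rw [norm_mul, Real.norm_eq_abs, Real.norm_eq_abs]
  exact mul_le_mul_of_nonneg_left (Tj_le hj hjb hb t) (abs_nonneg _)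

lemma Qj_diff {j : E2 → ℝ} {ε : ℝ} (hj : Continuous j) (hjb : ∀ z, |j z| ≤ ε)
    {a b : E2 → ℝ} (ha : Integrable a) (hb : Integrable b) (N m : ℝ)
    (hN1 : ∫ ξ, |a ξ| ≤ N) (hN2 : ∫ ξ, |b ξ| ≤ N) (hm : ∫ ξ, |a ξ - b ξ| ≤ m) :
    |Qj j a a - Qj j b b| ≤ 2 * ε * N * m := by
  have hab : Integrable (fun ξ => a ξ - b ξ) := ha.sub hb
  have hε : 0 ≤ ε := (abs_nonneg _).trans (hjb 0)
  have e : Qj j a a - Qj j b b = Qj j (fun ξ => a ξ - b ξ) a + Qj j b (fun ξ => a ξ - b ξ) := by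
    have hT : ∀ ξ, Tj j (fun ξ => a ξ - b ξ) ξ = Tj j a ξ - Tj j b ξ := by
      intro ξ
      simp only [Tj]
      rw [← integral_sub (jb_int hj hjb ha ξ) (jb_int hj hjb hb ξ)]
      congr 1; ext η; ring
    unfold Qj
    rw [← integral_sub (aT_int hj hjb ha ha) (aT_int hj hjb hb hb),
      ← integral_add (aT_int hj hjb hab ha) (aT_int hj hjb hb hab)]
    congr 1; ext ξ; rw [hT]; ring
  have h1 := Qj_le hj hjb hab ha
  have h2 := Qj_le hj hjb hb hab
  have hN0 : 0 ≤ N := (integral_nonneg fun _ => abs_nonneg _).trans hN1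
  have hm0 : 0 ≤ m := (integral_nonneg fun _ => abs_nonneg _).trans hm
  have n1 : 0 ≤ ∫ ξ, |a ξ| := integral_nonneg fun _ => abs_nonneg _
  have n2 : 0 ≤ ∫ ξ, |b ξ| := integral_nonneg fun _ => abs_nonneg _
  have n3 : 0 ≤ ∫ ξ, |a ξ - b ξ| := integral_nonneg fun _ => abs_nonneg _
  rw [e]
  calc _ ≤ _ := abs_add_le _ _
    _ ≤ ε * m * N + ε * N * m := by
      refine add_le_add (h1.trans ?_) (h2.trans ?_) <;> gcongr
    _ = _ := by ring

/-- decomposition of the double integral -/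
lemma dbl_eq {j : E2 → ℝ} {ε : ℝ} (hj : Continuous j) (hjb : ∀ z, |j z| ≤ ε)
    (J a : E2 → ℝ) (ha : Integrable a)
    (hJ : ∀ ξ η, a ξ ≠ 0 → a η ≠ 0 → J (ξ - η) = 1 + j (ξ - η)) :
    ∫ ξ, ∫ η, a ξ * J (ξ - η) * a η = (∫ ξ, a ξ) ^ 2 + Qj j a a := by
  have e : ∀ ξ, ∫ η, a ξ * J (ξ - η) * a η = a ξ * (∫ η, a η) + a ξ * Tj j a ξ := by
    intro ξ
    rw [Tj, ← mul_add, ← integral_add ha (jb_int hj hjb ha ξ), ← integral_const_mul]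
    congr 1; ext η
    by_cases h1 : a ξ = 0
    · simp [h1]
    by_cases h2 : a η = 0
    · simp [h2]
    rw [hJ ξ η h1 h2]; ring
  simp only [e]
  rw [integral_add (ha.mul_const _) (aT_int hj hjb ha ha), integral_mul_const, Qj]; ring


/-- the scaled intensity with unit kernel scale -/
def FI (K j u : E2 → ℝ) (x : E2) : ℝ :=
  (∫ ξ, u ξ * K (x - ξ)) ^ 2 + Qj j (fun ξ => u ξ * K (x - ξ)) (fun ξ => u ξ * K (x - ξ))

lemma int_abs_sub (f : E2 → ℝ) (z : E2) : ∫ y, |f (z - y)| = ∫ y, |f y| :=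
  integral_sub_left_eq_self (fun y => |f y|) volume z

set_option maxHeartbeats 4000000 in
lemma core_incr (a₁ δt : ℝ) (ha₁ : 0 < a₁) (hδt0 : 0 < δt) (hδt1 : δt ≤ 1 / 24) (hδt2 : δt ≤ a₁ / 2)
    (good : Set E2 → Prop) (hgood : ∀ D, good D → IsOpen D)
    (hdir : ∀ D, good D → ∀ y, 1 / 2 ≤ convK D Gauss y → convK D Gauss y ≤ 9 / 10 →
      ∃ v : E2, ‖v‖ = 1 ∧
      11 / 12 * a₁ ≤ ∑ i, v i * ∫ w, D.indicator (fun _ => (1 : ℝ)) w * dG i (y - w))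
    (ψ : E2 → ℝ) (ψ2 : Fin 2 → E2 → ℝ)
    (hψint : Integrable ψ)
    (hψ2 : ∀ i, IsWeakPartialDeriv i ψ (ψ2 i) ∧ Integrable (ψ2 i))
    (hψnorm : (∫ x, |ψ x|) + (∑ i, ∫ x, |ψ2 i x|) ≤ δt) :
    ∃ ε₀ γ₀ T : ℝ, 0 < ε₀ ∧ 0 < γ₀ ∧ 0 < T ∧ ∀ j : E2 → ℝ, Continuous j → (∀ z, |j z| ≤ ε₀) →
      ∀ u : E2 → ℝ, Measurable u → (∀ x, u x ∈ Icc (0 : ℝ) 1) → ∀ D, good D →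
      Integrable (fun x => u x - D.indicator (fun _ => (1 : ℝ)) x) →
      ∫ x, |u x - D.indicator (fun _ => (1 : ℝ)) x| ≤ γ₀ →
      ∀ h : ℝ, 1 / 3 ≤ h → h ≤ 2 / 3 → ∀ x, |FI (fun z => Gauss z + ψ z) j u x - h| ≤ 1 / 1000 →
      ∃ v : E2, ‖v‖ = 1 ∧ ∀ α β, -T ≤ α → α ≤ β → β ≤ T →
        a₁ / 4 * (β - α) ≤ FI (fun z => Gauss z + ψ z) j u (x + β • v) - FI (fun z => Gauss z + ψ z) j u (x + α • v) := by
  set K : E2 → ℝ := fun z => Gauss z + ψ z with hK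
  set K2 : Fin 2 → E2 → ℝ := fun i z => dG i z + ψ2 i z with hK2
  have hKi : Integrable K := gauss_int.add hψint
  have hK2i : ∀ i, Integrable (K2 i) := fun i => (dG_int i).add (hψ2 i).2
  have hK2w : ∀ i, IsWeakPartialDeriv i K (K2 i) ∧ Integrable (K2 i) := fun i =>
    ⟨weak_add gauss_int (dG_int i) hψint (hψ2 i).2 (gauss_weak i) (hψ2 i).1, hK2i i⟩
  have hψ0 : 0 ≤ ∫ x, |ψ x| := integral_nonneg fun _ => abs_nonneg _
  have hψ20 : ∀ i, 0 ≤ ∫ x, |ψ2 i x| := fun i => integral_nonneg fun _ => abs_nonneg _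
  have hψs0 : 0 ≤ ∑ i, ∫ x, |ψ2 i x| := Finset.sum_nonneg fun i _ => hψ20 i
  have hKn : ∫ x, |K x| ≤ 2 := by
    calc ∫ x, |K x| ≤ ∫ x, (Gauss x + |ψ x|) := by
          refine integral_mono hKi.abs (gauss_int.add hψint.abs) fun x => ?_
          refine (abs_add_le _ _).trans (le_of_eq ?_)
          rw [abs_of_pos (gauss_pos x)]
      _ = 1 + ∫ x, |ψ x| := by rw [integral_add gauss_int hψint.abs, gauss_integral]
      _ ≤ 2 := by linarith
  set C := ∑ i, ∫ y, |K2 i y| with hC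
  have hC0 : 0 ≤ C := Finset.sum_nonneg fun i _ => integral_nonneg fun _ => abs_nonneg _
  set η := min (1 / 100) (a₁ / 100) with hη
  have hη0 : 0 < η := by positivity
  have hη1 : η ≤ 1 / 100 := min_le_left _ _
  have hη2 : η ≤ a₁ / 100 := min_le_right _ _
  obtain ⟨γG, hγG, hG⟩ := unif_int Gauss gauss_int η hη0
  obtain ⟨γd0, hγd0, hd0⟩ := unif_int (dG 0) (dG_int 0) η hη0
  obtain ⟨γd1, hγd1, hd1⟩ := unif_int (dG 1) (dG_int 1) η hη0
  obtain ⟨T0, hT0, ht0⟩ := dG_trans 0 η hη0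
  obtain ⟨T1, hT1, ht1⟩ := dG_trans 1 η hη0
  refine ⟨min (1 / 1000) (a₁ / (48 * (C + 1))), min γG (min γd0 γd1), min (min T0 T1) (7 / 100 / (C + 1)),
    by positivity, by positivity, by positivity, ?_⟩
  set ε₀ := min (1 / 1000) (a₁ / (48 * (C + 1))) with hε₀
  set γ₀ := min γG (min γd0 γd1) with hγ₀
  set T := min (min T0 T1) (7 / 100 / (C + 1)) with hT
  have hε1 : ε₀ ≤ 1 / 1000 := min_le_left _ _
  have hε2 : ε₀ * C ≤ a₁ / 48 := by
    have : ε₀ ≤ a₁ / (48 * (C + 1)) := min_le_right _ _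
    calc ε₀ * C ≤ a₁ / (48 * (C + 1)) * C := by gcongr
      _ ≤ a₁ / 48 := by
        rw [div_mul_eq_mul_div, div_le_div_iff₀ (by positivity) (by norm_num)]
        nlinarith
  have hTC : T * C ≤ 7 / 100 := by
    have : T ≤ 7 / 100 / (C + 1) := min_le_right _ _
    calc T * C ≤ 7 / 100 / (C + 1) * C := by gcongr
      _ ≤ 7 / 100 := by
        rw [div_mul_eq_mul_div, div_le_iff₀ (by positivity)]
        nlinarith
  have hTT0 : T ≤ T0 := (min_le_left _ _).trans (min_le_left _ _)
  have hTT1 : T ≤ T1 := (min_le_left _ _).trans (min_le_right _ _)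
  have hg1 : γ₀ ≤ γG := min_le_left _ _
  have hg2 : γ₀ ≤ γd0 := (min_le_right _ _).trans (min_le_left _ _)
  have hg3 : γ₀ ≤ γd1 := (min_le_right _ _).trans (min_le_right _ _)
  have hTpos : 0 < T := by positivity
  clear_value ε₀ γ₀ T η
  intro j hj hjb u hum hu01 D hgD hwi hwγ h hh1 hh2 x hx
  have hDo := hgood D hgD
  have hε0 : 0 ≤ ε₀ := (abs_nonneg _).trans (hjb 0)
  set χ : E2 → ℝ := D.indicator (fun _ => (1 : ℝ)) with hχ
  have hχm : Measurable χ := ind_meas hDo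
  have hχb : ∀ x, |χ x| ≤ 1 := ind_abs_le D
  have hχ0 : ∀ x, 0 ≤ χ x := fun x => indicator_nonneg (fun _ _ => zero_le_one) _
  have hub : ∀ x, |u x| ≤ 1 := fun x => by
    rw [abs_of_nonneg (hu01 x).1]; exact (hu01 x).2
  set w : E2 → ℝ := fun x => u x - χ x with hw
  have hwb : ∀ x, |w x| ≤ 1 := fun x => by
    have h1 := hu01 x
    have h2 := (abs_le.1 (hχb x)).2
    have h3 := hχ0 x
    rw [hw, abs_le]; constructor <;> simp only <;> linarith [h1.1, h1.2]
  set V : E2 → ℝ := fun x => ∫ ξ, u ξ * K (x - ξ) with hV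
  have split : ∀ (f g : E2 → ℝ), Integrable f → Integrable g → ∀ z,
      ∫ y, u y * (f (z - y) + g (z - y)) = (∫ y, χ y * f (z - y)) + (∫ y, w y * f (z - y)) + ∫ y, u y * g (z - y) := by
    intro f g hf hg z
    have i1 := mul_sub_integrable hf hχm.aestronglyMeasurable hχb z
    have i2 := mul_sub_integrable hf hwi.aestronglyMeasurable hwb z
    have i3 := mul_sub_integrable hg hum.aestronglyMeasurable hub z
    have i12 : Integrable (fun y => χ y * f (z - y) + w y * f (z - y)) := i1.add i2
    rw [← integral_add i1 i2, ← integral_add i12 i3]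
    congr 1; ext y; simp only [hw]; ring
  -- closeness of V and P
  have hVP : |V x - convK D Gauss x| ≤ η + 1 / 24 := by
    have e := split Gauss ψ gauss_int hψint x
    have b1 := hG w hwi hwb (hwγ.trans hg1) x
    have b2 := abs_conv_le hψint hub x
    have e' : V x - convK D Gauss x = (∫ y, w y * Gauss (x - y)) + ∫ y, u y * ψ (x - y) := by
      simp only [hV, hK, convK]; rw [e]; ring
    rw [e']
    refine (abs_add_le _ _).trans ?_
    linarith
  have hP0 : 0 ≤ convK D Gauss x := integral_nonneg fun y => mul_nonneg (hχ0 y) (gauss_pos _).le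
  have hai : ∀ z, Integrable (fun ξ => u ξ * K (z - ξ)) := fun z =>
    mul_sub_integrable hKi hum.aestronglyMeasurable hub z
  have han : ∀ z, ∫ ξ, |u ξ * K (z - ξ)| ≤ 2 := by
    intro z
    refine le_trans ?_ hKn
    rw [← int_abs_sub K z]
    refine integral_mono (hai z).abs (sub_integrable hKi z).abs fun ξ => ?_
    simp only [abs_mul]
    exact mul_le_of_le_one_left (abs_nonneg _) (hub ξ)
  have hQ : |Qj j (fun ξ => u ξ * K (x - ξ)) (fun ξ => u ξ * K (x - ξ))| ≤ 4 / 1000 := by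
    refine (Qj_le hj hjb (hai x) (hai x)).trans ?_
    have n1 : 0 ≤ ∫ ξ, |u ξ * K (x - ξ)| := integral_nonneg fun _ => abs_nonneg _
    calc _ ≤ 1 / 1000 * 2 * (2:ℝ) := by
          have := han x
          gcongr
      _ = _ := by norm_num
  have hFI : FI K j u x = V x ^ 2 + Qj j (fun ξ => u ξ * K (x - ξ)) (fun ξ => u ξ * K (x - ξ)) := rfl
  rw [hFI] at hx
  have hx' := abs_le.1 hx
  have hQ' := abs_le.1 hQ
  have hVP' := abs_le.1 hVP
  have hVlo : 572 / 1000 ≤ V x := by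
    by_contra hc
    push Not at hc
    have : V x ^ 2 ≤ (572 / 1000) ^ 2 := sq_le_sq' (by linarith [hVP'.1]) hc.le
    linarith [hx'.1, hQ'.2]
  have hVhi : V x ≤ 82 / 100 := by
    by_contra hc
    push Not at hc
    have : (82 / 100) ^ 2 ≤ V x ^ 2 := pow_le_pow_left₀ (by norm_num) hc.le 2
    linarith [hx'.2, hQ'.1]
  obtain ⟨v, hv, hvg⟩ := hdir D hgD x (by linarith [hVP'.2]) (by linarith [hVP'.1])
  refine ⟨v, hv, fun α β hα hαβ hβ => ?_⟩
  set W : ℝ → ℝ := fun τ => ∑ i, v i * ∫ y, u y * K2 i (x + τ • v - y) with hW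
  have hWc : Continuous W := by
    refine continuous_finsetSum _ fun i _ => continuous_const.mul ?_
    exact (conv_cont (K2 i) u (hK2i i) hum 1 hub).comp (by fun_prop : Continuous fun τ : ℝ => x + τ • v)
  have hftc : ∀ a b : ℝ, V (x + b • v) - V (x + a • v) = ∫ τ in a..b, W τ := fun a b =>
    weak_ftc K K2 hKi hK2w u hum 1 hub x v a b
  have hvi : ∀ i, |v i| ≤ 1 := fun i => by rw [← hv]; exact abs_coord_le v i
  have hWlo : ∀ τ, -T ≤ τ → τ ≤ T → a₁ / 3 ≤ W τ := by
    intro τ h1 h2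
    have hτ : ‖τ • v‖ ≤ T := by
      rw [norm_smul, hv, mul_one, Real.norm_eq_abs, abs_le]; exact ⟨h1, h2⟩
    have trip : ∀ i, |(∫ y, u y * K2 i (x + τ • v - y)) - ∫ y, χ y * dG i (x - y)| ≤ 2 * η + ∫ y, |ψ2 i y| := by
      intro i
      have e := split (dG i) (ψ2 i) (dG_int i) (hψ2 i).2 (x + τ • v)
      have b1 : |∫ y, w y * dG i (x + τ • v - y)| ≤ η := by
        fin_cases i
        · exact hd0 w hwi hwb (hwγ.trans hg2) _
        · exact hd1 w hwi hwb (hwγ.trans hg3) _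
      have b2 := abs_conv_le (hψ2 i).2 hub (x + τ • v)
      have b3 : ∫ y, |dG i (y + τ • v) - dG i y| ≤ η := by
        fin_cases i
        · exact ht0 _ (hτ.trans hTT0)
        · exact ht1 _ (hτ.trans hTT1)
      have b4 := conv_dG_diff χ hχm hχb i x (τ • v)
      have e' : (∫ y, u y * K2 i (x + τ • v - y)) - ∫ y, χ y * dG i (x - y)
          = ((∫ y, χ y * dG i (x + τ • v - y)) - ∫ y, χ y * dG i (x - y))
            + (∫ y, w y * dG i (x + τ • v - y)) + ∫ y, u y * ψ2 i (x + τ • v - y) := by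
        simp only [hK2]; rw [e]; ring
      rw [e']
      refine (abs_add_three _ _ _).trans ?_
      linarith
    have hdiff : |W τ - ∑ i, v i * ∫ y, χ y * dG i (x - y)| ≤ 4 * η + ∑ i, ∫ y, |ψ2 i y| := by
      rw [hW]
      simp only
      rw [← Finset.sum_sub_distrib]
      refine (Finset.abs_sum_le_sum_abs _ _).trans ?_
      calc _ ≤ ∑ i : Fin 2, (2 * η + ∫ y, |ψ2 i y|) := by
            refine Finset.sum_le_sum fun i _ => ?_
            rw [← mul_sub, abs_mul]
            calc _ ≤ 1 * (2 * η + ∫ y, |ψ2 i y|) := by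
                  refine mul_le_mul (hvi i) (trip i) (abs_nonneg _) zero_le_one
              _ = _ := one_mul _
        _ = _ := by rw [Finset.sum_add_distrib]; simp; ring
    have := (abs_le.1 hdiff).1
    linarith
  have hVb : ∀ a, -T ≤ a → a ≤ T → 1 / 2 ≤ V (x + a • v) := by
    intro a h1 h2
    have hle : |V (x + a • v) - V (x + (0:ℝ) • v)| ≤ C * |a - 0| := by
      rw [hftc, ← Real.norm_eq_abs]
      refine intervalIntegral.norm_integral_le_of_norm_le_const fun τ _ => ?_
      refine (norm_sum_le _ _).trans (Finset.sum_le_sum fun i _ => ?_)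
      rw [Real.norm_eq_abs, abs_mul]
      have h2 := abs_conv_le (hK2i i) hub (x + τ • v)
      calc |v i| * _ ≤ 1 * (1 * ∫ y, |K2 i y|) := by
            have := hvi i
            gcongr
        _ = _ := by ring
    rw [zero_smul, add_zero, sub_zero] at hle
    have h3 : |a| ≤ T := abs_le.2 ⟨h1, h2⟩
    have h4 : C * |a| ≤ T * C := by rw [mul_comm]; gcongr
    linarith [(abs_le.1 hle).1]
  have hinc : a₁ / 3 * (β - α) ≤ V (x + β • v) - V (x + α • v) := by
    rw [hftc]
    have : ∫ τ in α..β, a₁ / 3 ≤ ∫ τ in α..β, W τ := by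
      refine intervalIntegral.integral_mono_on hαβ (by simp) (hWc.intervalIntegrable _ _) fun τ hτ => ?_
      exact hWlo τ (by linarith [hτ.1]) (by linarith [hτ.2])
    rw [intervalIntegral.integral_const, smul_eq_mul] at this
    linarith
  have hQd : |Qj j (fun ξ => u ξ * K (x + β • v - ξ)) (fun ξ => u ξ * K (x + β • v - ξ))
      - Qj j (fun ξ => u ξ * K (x + α • v - ξ)) (fun ξ => u ξ * K (x + α • v - ξ))| ≤ 2 * ε₀ * 2 * (|β - α| * C) := by
    refine Qj_diff hj hjb (hai _) (hai _) 2 (|β - α| * C) (han _) (han _) ?_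
    refine le_trans ?_ (l1_trans K K2 hKi hK2w x v hv α β)
    refine integral_mono ((hai _).sub (hai _)).abs ((sub_integrable hKi _).sub (sub_integrable hKi _)).abs fun ξ => ?_
    simp only [Pi.sub_apply, ← mul_sub, abs_mul]
    exact mul_le_of_le_one_left (abs_nonneg _) (hub ξ)
  rw [abs_of_nonneg (by linarith : 0 ≤ β - α)] at hQd
  have hFI2 : ∀ z, FI K j u z = V z ^ 2 + Qj j (fun ξ => u ξ * K (z - ξ)) (fun ξ => u ξ * K (z - ξ)) := fun _ => rfl
  rw [hFI2, hFI2]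
  have hβα : 0 ≤ β - α := by linarith
  have q1 := (abs_le.1 hQd).1
  have q2 : 2 * ε₀ * 2 * ((β - α) * C) ≤ a₁ / 12 * (β - α) := by
    have : (ε₀ * C) * (β - α) ≤ a₁ / 48 * (β - α) := by gcongr
    linarith
  have va := hVb α hα (by linarith)
  have vb := hVb β (by linarith) hβ
  have hd : 0 ≤ a₁ / 3 * (β - α) := by positivity
  have : V (x + β • v) - V (x + α • v) ≤ V (x + β • v) ^ 2 - V (x + α • v) ^ 2 := by
    nlinarith
  linarith

lemma int_smul (s : ℝ) (hs : 0 < s) (f : E2 → ℝ) : ∫ x, f x = s ^ 2 * ∫ x, f (s • x) := by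
  rw [Measure.integral_comp_smul]
  simp
  field_simp

lemma intensity_eq (K J u j : E2 → ℝ) (s : ℝ) (hs : 0 < s) (hK : Integrable K) (hu : Measurable u)
    (hub : ∀ x, |u x| ≤ 1) (ε : ℝ) (hj : Continuous j) (hjb : ∀ z, |j z| ≤ ε)
    (hJ : ∀ ξ η, u (s • ξ) ≠ 0 → u (s • η) ≠ 0 → J (s • (ξ - η)) = 1 + j (ξ - η)) (x : E2) :
    intensity K s J u x = FI K j (fun z => u (s • z)) (s⁻¹ • x) := by
  set a : E2 → ℝ := fun ξ => u (s • ξ) * K (s⁻¹ • x - ξ) with ha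
  have hai : Integrable a :=
    mul_sub_integrable hK (hu.comp (measurable_const_smul s)).aestronglyMeasurable (M := 1) (fun z => hub _) _
  have h1 := dbl_eq hj hjb (fun z => J (s • z)) a hai (by
    intro ξ η h1 h2
    refine hJ ξ η ?_ ?_
    · intro h; simp [ha, h] at h1
    · intro h; simp [ha, h] at h2)
  have h2 : FI K j (fun z => u (s • z)) (s⁻¹ • x) = (∫ ξ, a ξ) ^ 2 + Qj j a a := rfl
  rw [h2, ← h1, intensity, int_smul s hs, ← integral_const_mul]
  congr 1; ext ξ
  rw [int_smul s hs, ← integral_const_mul, ← integral_const_mul]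
  congr 1; ext η
  have e : ∀ ζ : E2, resc s K (x - s • ζ) = (s⁻¹) ^ 2 * K (s⁻¹ • x - ζ) := by
    intro ζ
    rw [resc, smul_sub, smul_smul, inv_mul_cancel₀ hs.ne', one_smul]
  rw [e, e, ← smul_sub]
  simp only [ha]
  field_simp

/-- scaled isometry -/
def scIso (s : ℝ) (hs : 0 < s) (A : E2 ≃ᵢ E2) : E2 ≃ᵢ E2 where
  toFun y := s⁻¹ • A (s • y)
  invFun y := s⁻¹ • A.symm (s • y)
  left_inv y := by simp [smul_smul, mul_inv_cancel₀ hs.ne', inv_mul_cancel₀ hs.ne']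
  right_inv y := by simp [smul_smul, mul_inv_cancel₀ hs.ne', inv_mul_cancel₀ hs.ne']
  isometry_toFun := by
    refine Isometry.of_dist_eq fun y z => ?_
    rw [dist_smul₀, A.isometry.dist_eq, dist_smul₀, ← mul_assoc, ← norm_mul, inv_mul_cancel₀ hs.ne']
    simp

lemma scIso_apply (s : ℝ) (hs : 0 < s) (A : E2 ≃ᵢ E2) (y : E2) : scIso s hs A y = s⁻¹ • A (s • y) := rfl

lemma lip_scale (s r L : ℝ) (hs : 0 < s) (hL : 0 < L) (D : Set E2) (h : IsLipDomain (s * r) L D) :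
    IsLipDomain r L ((fun z : E2 => s • z) ⁻¹' D) := by
  intro x hx
  have hx' : s • x ∈ frontier D := by
    have := (Homeomorph.smulOfNeZero s hs.ne' : E2 ≃ₜ E2).preimage_frontier D
    have h2 : (fun z : E2 => s • z) ⁻¹' frontier D = frontier ((fun z : E2 => s • z) ⁻¹' D) := this
    rw [← h2] at hx
    exact hx
  obtain ⟨A, φ, h1, h2, h3, h4⟩ := h _ hx'
  refine ⟨scIso s hs A, fun t => s⁻¹ * φ (s * t), ?_, ?_, ?_, ?_⟩
  · rw [scIso_apply, h1, smul_zero]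
  · refine LipschitzWith.of_dist_le_mul fun t t' => ?_
    have := h2.dist_le_mul (s * t) (s * t')
    rw [Real.dist_eq, Real.dist_eq] at this ⊢
    rw [← mul_sub, abs_mul s, abs_of_pos hs] at this
    rw [← mul_sub, abs_mul, abs_of_pos (inv_pos.2 hs), inv_mul_le_iff₀ hs]
    refine this.trans (le_of_eq ?_)
    ring
  · simp [h3]
  · intro y hy
    have hy' : s • y ∈ ball (s • x) (s * r) := by
      rw [mem_ball, dist_smul₀, Real.norm_eq_abs, abs_of_pos hs]
      exact mul_lt_mul_of_pos_left hy hs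
    have := h4 _ hy'
    change s • y ∈ D ↔ _
    rw [this, scIso_apply]
    simp only [PiLp.smul_apply, smul_eq_mul]
    rw [← mul_assoc, mul_inv_cancel₀ hs.ne', one_mul]
    exact (mul_lt_mul_iff_right₀ (inv_pos.2 hs)).symm

lemma cross_frontier (I : E2 → ℝ) (h : ℝ) (x w : E2) (ε : ℝ) (hw : ‖w‖ < ε)
    (h1 : h < I (x + w)) (h2 : I (x - w) < h) : x ∈ thickening ε (frontier {x | h < I x}) := by
  have hpre : IsPreconnected (segment ℝ (x - w) (x + w)) := (convex_segment _ _).isPreconnected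
  obtain ⟨z, hz1, hz2⟩ := pre_frontier (s := {x | h < I x}) hpre ⟨x + w, right_mem_segment _ _ _, h1⟩
    ⟨x - w, left_mem_segment _ _ _, fun hc => by
      have : h < I (x - w) := hc
      linarith⟩
  rw [mem_thickening_iff]
  refine ⟨z, hz2, ?_⟩
  have : segment ℝ (x - w) (x + w) ⊆ ball x ε := by
    refine (convex_ball x ε).segment_subset ?_ ?_ <;> simp [hw]
  rw [dist_comm]; exact this hz1

theorem stmt18 (L : ℝ) (hL : 0 < L)
    (δ δ₁ m₁ R₀ htil a₁ : ℝ)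
    (hδ : 0 < δ) (hδ₁ : 0 < δ₁) (hδ₁2 : δ₁ ≤ 1 / 2) (hm₁ : 0 < m₁) (hm₁2 : m₁ ≤ 1)
    (hR₀ : 1 ≤ R₀) (hhtil : 0 < htil) (hhtil2 : htil ≤ 1 / 24) (ha₁ : 0 < a₁)
    -- the Gaussian boundary-localization estimates at scale `R₀` (constants from `L`):
    (hloc : ∀ D : Set E2, IsOpen D → Bornology.IsBounded D → IsLipDomain R₀ L D →
      ∀ x : E2, htil < convK D Gauss x → convK D Gauss x < 1 - htil →
        Metric.infDist x (frontier D) ≤ m₁ * δ * R₀)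
    (hgrad : ∀ D : Set E2, IsOpen D → Bornology.IsBounded D → IsLipDomain R₀ L D →
      ∀ x ∈ frontier D, ∀ (A : E2 ≃ᵢ E2) (φ : ℝ → ℝ),
        A x = 0 → LipschitzWith (Real.toNNReal L) φ → φ 0 = 0 →
        (∀ y ∈ ball x R₀, (y ∈ D ↔ (A y) 1 < φ ((A y) 0))) →
        ∀ y : E2, |(A y) 0| ≤ δ₁ * R₀ →
          φ ((A y) 0) - δ * R₀ ≤ (A y) 1 → (A y) 1 ≤ φ ((A y) 0) + δ * R₀ →
          a₁ ≤ fderiv ℝ (convK D Gauss) y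
            (A.symm (A y - EuclideanSpace.single (1 : Fin 2) (1 : ℝ)) - y))
    (htail : ∫ x in (ball (0 : E2) (R₀ / 2))ᶜ, ‖fderiv ℝ Gauss x‖ ≤ a₁ / 12)
    (R : ℝ) (hR : 10 * R₀ ≤ R)
    (p : ℝ) (hp : 4 < p)
    -- the perturbation `ψ ∈ W^{2,1}` with `‖ψ‖_{W^{1,1}} ≤ δ̃ ≤ min {h̃, a₁/2}`:
    (δt : ℝ) (hδt : 0 < δt) (hδt2 : δt ≤ min htil (a₁ / 2))
    (ψ : E2 → ℝ) (ψ2 : Fin 2 → E2 → ℝ) (ψ3 : Fin 2 → Fin 2 → E2 → ℝ)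
    (hψint : Integrable ψ)
    (hψ2 : ∀ i, IsWeakPartialDeriv i ψ (ψ2 i) ∧ Integrable (ψ2 i))
    (hψ3 : ∀ i j, IsWeakPartialDeriv j (ψ2 i) (ψ3 i j) ∧ Integrable (ψ3 i j))
    (hψnorm : (∫ x, |ψ x|) + (∑ i, ∫ x, |ψ2 i x|) ≤ δt)
    (s₁ : ℝ) (hs₁ : 0 < s₁) (hs₁1 : s₁ ≤ 1) :
    ∃ ε₀ γ₀ : ℝ, 0 < ε₀ ∧ 0 < γ₀ ∧
      ∀ h : ℝ, 1 / 3 ≤ h → h ≤ 2 / 3 →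
      ∀ J : E2 → ℝ, Continuous J → (∀ x ∈ ball (0 : E2) (2 * R), |J x - 1| ≤ ε₀) →
      ∀ γ : ℝ, 0 < γ → γ ≤ γ₀ →
      ∃ g : ℝ → ℝ, ContinuousOn g (Ici 0) ∧ StrictMonoOn g (Ici 0) ∧ g 0 = 0 ∧
        (∀ t, 0 ≤ t → 0 ≤ g t) ∧
        ∀ u : E2 → ℝ, MemAgamma R (s₁ * R₀) L γ u →
          ∀ ε' : ℝ, 0 < ε' → ∀ x : E2,
            x ∉ thickening ε'
              (frontier (exposed (fun z => Gauss z + ψ z) s₁ J u h)) →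
            g ε' < |intensity (fun z => Gauss z + ψ z) s₁ J u x - h| := by
  obtain ⟨ε₀, γ₀, T, hε₀, hγ₀, hT, core⟩ := core_incr a₁ δt ha₁ hδt
    ((hδt2.trans (min_le_left _ _)).trans hhtil2) (hδt2.trans (min_le_right _ _))
    (fun D => IsOpen D ∧ Bornology.IsBounded D ∧ IsLipDomain R₀ L D) (fun D h => h.1)
    (fun D h y h1 h2 => core_dir L a₁ δ δ₁ m₁ R₀ htil hL hδ hm₁2 hR₀ ha₁ hδ₁ hhtil2 hloc hgrad htail D
      h.1 h.2.1 h.2.2 y h1 h2) ψ ψ2 hψint hψ2 hψnorm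
  refine ⟨ε₀, s₁ ^ 2 * γ₀, hε₀, by positivity, ?_⟩
  intro h hh1 hh2 J hJc hJ γ hγ hγ2
  set T' := min T 1 with hT'
  have hT'0 : 0 < T' := by positivity
  have hT'T : T' ≤ T := min_le_left _ _
  have hT'1 : T' ≤ 1 := min_le_right _ _
  set β₀ := min (1 / 1000) (a₁ / 4 * T' / 2) with hβ₀
  have hβ0 : 0 < β₀ := by positivity
  have hβ1 : β₀ ≤ 1 / 1000 := min_le_left _ _
  have hβ2 : β₀ ≤ a₁ / 4 * T' / 2 := min_le_right _ _
  clear_value T' β₀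
  refine ⟨fun t => β₀ * (t / (1 + t)), ?_, ?_, by simp, ?_, ?_⟩
  · refine continuousOn_const.mul (continuousOn_id.div (by fun_prop) fun t ht => ?_)
    have : (0:ℝ) ≤ t := ht
    positivity
  · intro t ht t' ht' htt
    have h1 : (0:ℝ) ≤ t := ht
    have h2 : (0:ℝ) ≤ t' := ht'
    refine mul_lt_mul_of_pos_left ?_ hβ0
    rw [div_lt_div_iff₀ (by positivity) (by positivity)]
    linarith
  · intro t ht; positivity
  intro u hu ε' hε' x hx
  obtain ⟨hum, hu01, husupp, D, hDo, hDR, hDlip, hDγ⟩ := hu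
  by_contra hcon
  push Not at hcon
  apply hx
  have hub : ∀ x, |u x| ≤ 1 := fun x => by
    rw [abs_of_nonneg (hu01 x).1]; exact (hu01 x).2
  -- the clamped kernel
  set j : E2 → ℝ := fun z => max (-ε₀) (min ε₀ (J (s₁ • z) - 1)) with hj
  have hjc : Continuous j := by rw [hj]; fun_prop
  have hjb : ∀ z, |j z| ≤ ε₀ := fun z => by
    rw [hj, abs_le]
    exact ⟨le_max_left _ _, max_le (by linarith) (min_le_left _ _)⟩
  have hJj : ∀ ξ η, u (s₁ • ξ) ≠ 0 → u (s₁ • η) ≠ 0 → J (s₁ • (ξ - η)) = 1 + j (ξ - η) := by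
    intro ξ η h1 h2
    have m1 : s₁ • ξ ∈ ball (0 : E2) R := by
      by_contra hc; exact h1 (husupp _ hc)
    have m2 : s₁ • η ∈ ball (0 : E2) R := by
      by_contra hc; exact h2 (husupp _ hc)
    rw [mem_ball, dist_zero_right] at m1 m2
    have m3 : s₁ • (ξ - η) ∈ ball (0 : E2) (2 * R) := by
      rw [mem_ball, dist_zero_right, smul_sub]
      exact (norm_sub_le _ _).trans_lt (by linarith)
    have := abs_le.1 (hJ _ m3)
    rw [hj]
    simp only
    rw [min_eq_right this.2, max_eq_right this.1]; ring
  set K : E2 → ℝ := fun z => Gauss z + ψ z with hK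
  have hKi : Integrable K := gauss_int.add hψint
  have hIeq := intensity_eq K J u j s₁ hs₁ hKi hum hub ε₀ hjc hjb hJj
  set us : E2 → ℝ := fun z => u (s₁ • z) with hus
  set Ds : Set E2 := (fun z : E2 => s₁ • z) ⁻¹' D with hDs
  have hDb : Bornology.IsBounded D := Metric.isBounded_ball.subset hDR
  have hDsb : Bornology.IsBounded Ds := by
    refine (Metric.isBounded_ball (x := (0 : E2)) (r := s₁⁻¹ * R)).subset fun z hz => ?_
    have h1 := hDR hz
    rw [mem_ball, dist_zero_right, norm_smul, Real.norm_eq_abs, abs_of_pos hs₁] at h1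
    rw [mem_ball, dist_zero_right, inv_mul_eq_div, lt_div_iff₀ hs₁]
    linarith
  have hgood : IsOpen Ds ∧ Bornology.IsBounded Ds ∧ IsLipDomain R₀ L Ds :=
    ⟨hDo.preimage (continuous_const_smul s₁), hDsb, lip_scale s₁ R₀ L hs₁ hL D hDlip⟩
  have hui : Integrable u := by
    have hon : IntegrableOn u (ball (0 : E2) R) :=
      Measure.integrableOn_of_bounded (M := 1) measure_ball_lt_top.ne hum.aestronglyMeasurable
        (Filter.Eventually.of_forall hub)
    exact (integrableOn_iff_integrable_of_support_subset (fun z hz => by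
      by_contra hc; exact hz (husupp z hc))).1 hon
  have hχi : Integrable (D.indicator (fun _ => (1 : ℝ))) :=
    (integrable_indicator_iff hDo.measurableSet).2 (integrableOn_const hDb.measure_lt_top.ne)
  have hind : ∀ z, Ds.indicator (fun _ => (1 : ℝ)) z = D.indicator (fun _ => (1 : ℝ)) (s₁ • z) := fun z => rfl
  have hwi : Integrable (fun z => us z - Ds.indicator (fun _ => (1 : ℝ)) z) := by
    have := (hui.sub hχi).comp_smul hs₁.ne'
    exact this
  have hwγ : ∫ z, |us z - Ds.indicator (fun _ => (1 : ℝ)) z| ≤ γ₀ := by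
    have e := int_smul s₁ hs₁ (fun z => |u z - D.indicator (fun _ => (1 : ℝ)) z|)
    have e2 : s₁ ^ 2 * (∫ z, |us z - Ds.indicator (fun _ => (1 : ℝ)) z|) ≤ s₁ ^ 2 * γ₀ := by
      refine le_trans (le_of_eq ?_) (hDγ.trans hγ2)
      rw [e]
      rfl
    exact le_of_mul_le_mul_left e2 (by positivity)
  have hfrac1 : ε' / (1 + ε') < 1 := by rw [div_lt_one (by positivity)]; linarith
  have hfrac2 : ε' / (1 + ε') ≤ ε' := div_le_self hε'.le (by linarith)
  have hfrac0 : 0 < ε' / (1 + ε') := by positivity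
  set q := ε' / (1 + ε') with hq
  clear_value q
  have hβq : β₀ * q ≤ 1 / 1000 := (mul_le_of_le_one_right hβ0.le hfrac1.le).trans hβ1
  rw [hIeq] at hcon
  obtain ⟨v, hv, hinc⟩ := core j hjc hjb us (hum.comp (measurable_const_smul s₁)) (fun z => hu01 _) Ds hgood
    hwi hwγ h hh1 hh2 (s₁⁻¹ • x) (hcon.trans hβq)
  set τ := 3 / 4 * min ε' T' with hτ
  have hmin : 0 < min ε' T' := by positivity
  have hτ0 : 0 < τ := by positivity
  have hτT : τ ≤ T := by
    have : min ε' T' ≤ T' := min_le_right _ _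
    linarith
  have hτε : τ < ε' := by
    have : min ε' T' ≤ ε' := min_le_left _ _
    linarith
  have hgb : β₀ * q < a₁ / 4 * τ := by
    have h1 : T' * q ≤ min ε' T' := by
      exact le_min ((mul_le_of_le_one_left hfrac0.le hT'1).trans hfrac2)
        (mul_le_of_le_one_right hT'0.le hfrac1.le)
    have h2 : β₀ * q ≤ a₁ / 4 * T' / 2 * q := by gcongr
    have h3 : a₁ / 4 / 2 * (T' * q) ≤ a₁ / 4 / 2 * min ε' T' := by gcongr
    have h4 : 0 < a₁ * min ε' T' := by positivity
    rw [hτ]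
    linarith
  have hc' := abs_le.1 hcon
  have i1 := hinc 0 τ (by linarith) hτ0.le hτT
  have i2 := hinc (-τ) 0 (by linarith) (by linarith) hT.le
  simp only [zero_smul, add_zero, neg_smul] at i1 i2
  have hsm : s₁⁻¹ • (s₁ • (τ • v)) = τ • v := by rw [smul_smul, inv_mul_cancel₀ hs₁.ne', one_smul]
  refine cross_frontier (intensity K s₁ J u) h x (s₁ • (τ • v)) ε' ?_ ?_ ?_
  · rw [norm_smul, norm_smul, hv, Real.norm_eq_abs, Real.norm_eq_abs, abs_of_pos hs₁, abs_of_pos hτ0, mul_one]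
    exact (mul_le_of_le_one_left hτ0.le hs₁1).trans_lt hτε
  · rw [hIeq, smul_add, hsm]
    linarith [hc'.1]
  · rw [hIeq, smul_sub, hsm, sub_eq_add_neg]
    linarith [hc'.2]
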